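/- arXiv:2604.12417 — 14 statements merged into one kernel-verified Lean document; each statement's English description precedes it below -/
import Mathlib

section
/- Let A be any output of Truncated Max-Sum Greedy with threshold τ = (2/5)·OPT on an instance with n ≥ m ≥ 1 in which every item j ∈ J satisfies f({j}) < (2/5)·OPT. Then f_min(A) ≥ (2/5)·OPT. -/
open Finset

/-- Marginal contribution `Δ_f(j | S) = f(S ∪ {j}) − f(S)`. -/
def marg {ι : Type*} [DecidableEq ι] (f : Finset ι → ℝ) (j : ι) (S : Finset ι) : ℝ :=
  f (insert j S) - f S

/-- The set of items allocated by a (partial) allocation `A`. -/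
def allocSet {ι : Type*} [DecidableEq ι] {m : ℕ} (A : Fin m → Finset ι) : Finset ι :=
  Finset.univ.sup A

/-- One step of Truncated Max-Sum Greedy with threshold `τ`: allocate an unallocated item `j`
to a player `p` with `f(A p) < τ` so that the marginal contribution `Δ_f(j | A p)` is maximal
among all such pairs. -/
def GreedyStep {ι : Type*} [DecidableEq ι] {m : ℕ} (f : Finset ι → ℝ) (τ : ℝ)
    (J : Finset ι) (A A' : Fin m → Finset ι) : Prop :=
  ∃ j p, j ∈ J ∧ j ∉ allocSet A ∧ f (A p) < τ ∧
    (∀ j' ∈ J, j' ∉ allocSet A → ∀ p' : Fin m, f (A p') < τ →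
      marg f j' (A p') ≤ marg f j (A p)) ∧
    A' = Function.update A p (insert j (A p))

/-- A possible output of Truncated Max-Sum Greedy with threshold `τ` on items `J` with `m`
players: start by giving each of the `m` players one of the `m` items of largest singleton
value, then repeatedly perform greedy steps, stopping exactly when either all items are
allocated or all players have value at least `τ`. -/
def GreedyOutput {ι : Type*} [DecidableEq ι] (f : Finset ι → ℝ) (τ : ℝ) (J : Finset ι)
    (m : ℕ) (A : Fin m → Finset ι) : Prop :=
  ∃ g : Fin m ↪ ι, (∀ p, g p ∈ J) ∧
    (∀ j ∈ J, (∀ p, g p ≠ j) → ∀ p, f {j} ≤ f {g p}) ∧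
    Relation.ReflTransGen (GreedyStep f τ J) (fun p => {g p}) A ∧
    (allocSet A = J ∨ ∀ p, τ ≤ f (A p))

/-- `A` is an allocation: pairwise disjoint subsets of `J` covering `J`. -/
def IsAllocation {ι : Type*} (J : Finset ι) {m : ℕ} (A : Fin m → Finset ι) : Prop :=
  (∀ p, A p ⊆ J) ∧ (∀ p q : Fin m, p ≠ q → Disjoint (A p) (A q)) ∧ (∀ j ∈ J, ∃ p, j ∈ A p)


section helpers
variable {ι : Type*} [DecidableEq ι] {m : ℕ} {J : Finset ι} {f : Finset ι → ℝ} {τ : ℝ}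

lemma not_mem_alloc {A : Fin m → Finset ι} {j : ι} : j ∉ allocSet A ↔ ∀ q, j ∉ A q := by
  simp [allocSet, Finset.mem_sup]

lemma marg_nonneg (hmono : ∀ S T : Finset ι, S ⊆ T → T ⊆ J → f S ≤ f T)
    {S : Finset ι} {j : ι} (hS : S ⊆ J) (hj : j ∈ J) : 0 ≤ marg f j S := by
  have := hmono S (insert j S) (subset_insert _ _) (insert_subset hj hS)
  unfold marg; linarith

lemma marg_anti (hmono : ∀ S T : Finset ι, S ⊆ T → T ⊆ J → f S ≤ f T)
    (hsub : ∀ S T : Finset ι, S ⊆ J → T ⊆ J → f (S ∪ T) + f (S ∩ T) ≤ f S + f T)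
    {S T : Finset ι} {j : ι} (hST : S ⊆ T) (hT : T ⊆ J) (hj : j ∈ J) :
    marg f j T ≤ marg f j S := by
  by_cases h : j ∈ T
  · have h1 := marg_nonneg hmono (hST.trans hT) hj
    have h2 : marg f j T = 0 := by simp [marg, insert_eq_of_mem h]
    linarith
  · have h1 := hsub (insert j S) T (insert_subset hj (hST.trans hT)) hT
    have h2 : insert j S ∪ T = insert j T := by
      rw [insert_union, union_eq_right.2 hST]
    have h3 : insert j S ∩ T = S := by
      rw [insert_inter_of_notMem h, inter_eq_left.2 hST]
    rw [h2, h3] at h1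
    unfold marg; linarith

lemma sum_marg (hmono : ∀ S T : Finset ι, S ⊆ T → T ⊆ J → f S ≤ f T)
    (hsub : ∀ S T : Finset ι, S ⊆ J → T ⊆ J → f (S ∪ T) + f (S ∩ T) ≤ f S + f T)
    {P : Finset ι} (hP : P ⊆ J) (S : Finset ι) (hS : S ⊆ J) :
    f (P ∪ S) - f P ≤ ∑ j ∈ S, marg f j P := by
  induction S using Finset.induction_on with
  | empty => simp
  | insert a S ha ih =>
    have hSJ : S ⊆ J := (subset_insert _ _).trans hS
    have haJ : a ∈ J := hS (mem_insert_self _ _)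
    rw [sum_insert ha]
    have h1 := marg_anti hmono hsub (subset_union_left (s₁ := P) (s₂ := S))
      (union_subset hP hSJ) haJ
    have h2 := ih hSJ
    have h3 : marg f a (P ∪ S) = f (P ∪ insert a S) - f (P ∪ S) := by
      rw [marg, union_insert]
    linarith

lemma f_le_sum (hf0 : f ∅ = 0) (hmono : ∀ S T : Finset ι, S ⊆ T → T ⊆ J → f S ≤ f T)
    (hsub : ∀ S T : Finset ι, S ⊆ J → T ⊆ J → f (S ∪ T) + f (S ∩ T) ≤ f S + f T)
    (S : Finset ι) (hS : S ⊆ J) : f S ≤ ∑ j ∈ S, f {j} := by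
  have := sum_marg hmono hsub (empty_subset J) S hS
  simpa [marg, hf0] using this

/-- Invariants of the greedy run. -/
structure GInv (f : Finset ι → ℝ) (τ : ℝ) (J : Finset ι) (g : Fin m ↪ ι)
    (A : Fin m → Finset ι) : Prop where
  sub : ∀ q, A q ⊆ J
  gmem : ∀ q, g q ∈ A q
  disj : ∀ q r, q ≠ r → Disjoint (A q) (A r)
  bound : ∀ p P, A p ⊆ P → P ⊆ J → f (A p) < τ → ∀ q,
    ∑ j ∈ (A q).erase (g q), marg f j P ≤ f (A q) - f {g q}
  shape : ∀ q, A q = {g q} ∨ ∃ k ∈ A q, k ≠ g q ∧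
    (∀ j ∈ J, j ∉ allocSet A → marg f j {g q} ≤ marg f k {g q}) ∧
    (A q = {g q, k} ∨ f (A q) < 2 * τ - f {g q})
  upper : ∀ q r, f (A q) < τ + f {g r}

lemma ginv_init (hf0 : f ∅ = 0) (hmono : ∀ S T : Finset ι, S ⊆ T → T ⊆ J → f S ≤ f T)
    (hsmall : ∀ j ∈ J, f {j} < τ) (g : Fin m ↪ ι) (hg : ∀ p, g p ∈ J) :
    GInv f τ J g (fun p => {g p}) where
  sub q := by simpa using hg q
  gmem q := by simp
  disj q r h := by simpa using h
  bound p P _ _ _ q := by simp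
  shape q := Or.inl rfl
  upper q r := by
    have h1 := hsmall _ (hg q)
    have h2 := hmono ∅ {g r} (empty_subset _) (by simpa using hg r)
    show f {g q} < _
    linarith

lemma ginv_step (hf0 : f ∅ = 0) (hmono : ∀ S T : Finset ι, S ⊆ T → T ⊆ J → f S ≤ f T)
    (hsub : ∀ S T : Finset ι, S ⊆ J → T ⊆ J → f (S ∪ T) + f (S ∩ T) ≤ f S + f T)
    (g : Fin m ↪ ι)
    (hg2 : ∀ j ∈ J, (∀ p, g p ≠ j) → ∀ p, f {j} ≤ f {g p})
    {A A' : Fin m → Finset ι} (hI : GInv f τ J g A) (hs : GreedyStep f τ J A A') :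
    GInv f τ J g A' := by
  obtain ⟨j, s, hj, hjA, hlt, hmax, rfl⟩ := hs
  have hjA' := not_mem_alloc.1 hjA
  have hle : ∀ q, A q ⊆ Function.update A s (insert j (A s)) q := by
    intro q
    by_cases h : q = s
    · subst h; simp
    · simp [Function.update_of_ne h]
  have hsubs : ∀ q, Function.update A s (insert j (A s)) q ⊆ J := by
    intro q
    by_cases h : q = s
    · subst h; simpa using insert_subset hj (hI.sub q)
    · simpa [Function.update_of_ne h] using hI.sub q
  have hall : ∀ i, i ∉ allocSet (Function.update A s (insert j (A s))) → i ∉ allocSet A := by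
    intro i hi
    rw [not_mem_alloc] at hi ⊢
    exact fun q hq => hi q (hle q hq)
  have hjg : ∀ p, g p ≠ j := fun p h => hjA' p (h ▸ hI.gmem p)
  refine ⟨hsubs, fun q => hle q (hI.gmem q), ?_, ?_, ?_, ?_⟩
  · intro q r hqr
    by_cases h : q = s
    · subst h
      rw [Function.update_self, Function.update_of_ne hqr.symm, disjoint_insert_left]
      exact ⟨hjA' r, hI.disj q r hqr⟩
    · rw [Function.update_of_ne h]
      by_cases h' : r = s
      · subst h'
        rw [Function.update_self, disjoint_insert_right]
        exact ⟨hjA' q, hI.disj q r hqr⟩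
      · rw [Function.update_of_ne h']
        exact hI.disj q r hqr
  · intro p P hpP hPJ hp q
    have hpP' := (hle p).trans hpP
    have hp' : f (A p) < τ := lt_of_le_of_lt (hmono _ _ (hle p) (hsubs p)) hp
    have hb := hI.bound p P hpP' hPJ hp' q
    by_cases h : q = s
    · subst h
      rw [Function.update_self, erase_insert_of_ne (hjg q).symm, sum_insert]
      · have h1 := marg_anti hmono hsub hpP' hPJ hj
        have h2 := hmax j hj hjA p hp'
        have h3 : marg f j (A q) = f (insert j (A q)) - f (A q) := rfl
        linarith
      · exact fun hh => hjA' q (mem_of_mem_erase hh)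
    · rw [Function.update_of_ne h]; exact hb
  · intro q
    by_cases h : q = s
    · subst h
      right
      rw [Function.update_self]
      rcases hI.shape q with h1 | ⟨k, hk, hkg, hkm, -⟩
      · refine ⟨j, mem_insert_self _ _, (hjg q).symm, ?_, Or.inl ?_⟩
        · intro i hi hiA
          have := hmax i hi (hall i hiA) q hlt
          rwa [h1] at this
        · rw [h1, pair_comm]
      · refine ⟨k, mem_insert_of_mem hk, hkg, fun i hi hiA => hkm i hi (hall i hiA), Or.inr ?_⟩
        have h1 := hkm j hj hjA
        have h2 := marg_anti hmono hsub (singleton_subset_iff.2 (hI.gmem q)) (hI.sub q) hj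
        have h3 : marg f j (A q) = f (insert j (A q)) - f (A q) := rfl
        have h4 : marg f k {g q} = f (insert k {g q}) - f {g q} := rfl
        have h5 := hmono (insert k {g q}) (A q)
          (insert_subset hk (singleton_subset_iff.2 (hI.gmem q))) (hI.sub q)
        linarith
    · rw [Function.update_of_ne h]
      rcases hI.shape q with h1 | ⟨k, hk, hkg, hkm, h2⟩
      · exact Or.inl h1
      · exact Or.inr ⟨k, hk, hkg, fun i hi hiA => hkm i hi (hall i hiA), h2⟩
  · intro q r
    by_cases h : q = s
    · subst h
      rw [Function.update_self]
      have h1 := marg_anti hmono hsub (empty_subset (A q)) (hI.sub q) hj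
      have h2 : marg f j ∅ = f {j} := by simp [marg, hf0]
      have h3 : marg f j (A q) = f (insert j (A q)) - f (A q) := rfl
      have h4 := hg2 j hj hjg r
      linarith
    · rw [Function.update_of_ne h]; exact hI.upper q r

/-- Numerical core for a bundle of the optimal allocation. -/
lemma opt_core {u c x R : ℝ} (hc1 : u < c) (hc2 : c < 2 * u) (hx : x = max 0 (3 * u - 2 * c))
    (S : Finset ι) (v : ι → ℝ) (hv : ∀ j ∈ S, v j < 2 * u) (hR0 : 0 ≤ R)
    (hR : 3 * u - ∑ j ∈ S, v j ≤ R) :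
    2 * u + x ≤ R + ∑ j ∈ S, (u + min (max (v j - c) 0) x) := by
  have hx0 : 0 ≤ x := hx ▸ le_max_left _ _
  have hx1 : x ≤ u := by rw [hx]; apply max_le <;> linarith
  have hx2 : 3 * u - 2 * c ≤ x := hx ▸ le_max_right _ _
  have hnn : ∀ j ∈ S, 0 ≤ min (max (v j - c) 0) x := fun j _ => le_min (le_max_right _ _) hx0
  rw [sum_add_distrib, sum_const, nsmul_eq_mul]
  have hsn := sum_nonneg hnn
  rcases Nat.lt_or_ge S.card 3 with hcard | hcard
  · interval_cases h : S.card
    · rw [card_eq_zero] at h; subst h; simp at *; linarith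
    · obtain ⟨a, rfl⟩ := card_eq_one.1 h
      simp only [sum_singleton, mem_singleton, forall_eq] at *
      push_cast
      rcases max_cases (v a - c) 0 with h1 | h1 <;>
      rcases min_cases (max (v a - c) 0) x with h2 | h2 <;>
      rcases max_cases 0 (3 * u - 2 * c) with h3 | h3 <;> linarith
    · obtain ⟨a, b, hab, rfl⟩ := card_eq_two.1 h
      rw [sum_pair hab] at *
      have ha := hnn a (by simp)
      have hb := hnn b (by simp)
      push_cast
      rcases max_cases (v a - c) 0 with h1 | h1 <;>
      rcases min_cases (max (v a - c) 0) x with h2 | h2 <;>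
      rcases max_cases (v b - c) 0 with h4 | h4 <;>
      rcases min_cases (max (v b - c) 0) x with h5 | h5 <;>
      rcases max_cases 0 (3 * u - 2 * c) with h3 | h3 <;> linarith
  · have : (3 : ℝ) ≤ S.card := by exact_mod_cast hcard
    nlinarith

lemma sum_alloc {A : Fin m → Finset ι} (hA : IsAllocation J A) (φ : ι → ℝ) :
    ∑ j ∈ J, φ j = ∑ q, ∑ j ∈ A q, φ j := by
  rw [← sum_biUnion (fun q _ r _ h => hA.2.1 q r h)]
  congr 1
  ext j
  simp only [mem_biUnion, mem_univ, true_and]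
  exact ⟨hA.2.2 j, fun ⟨q, hq⟩ => hA.1 q hq⟩

end helpers

/-- any output of Truncated Max-Sum Greedy with threshold `(2/5)·OPT`, on an
instance with `n ≥ m ≥ 1` in which every item has singleton value `< (2/5)·OPT`, satisfies
`f_min(A) ≥ (2/5)·OPT`. -/
theorem stmt0 {ι : Type*} [DecidableEq ι] {m : ℕ} (hm : 1 ≤ m)
    (J : Finset ι) (hn : m ≤ J.card)
    (f : Finset ι → ℝ) (hf0 : f ∅ = 0)
    (hmono : ∀ S T : Finset ι, S ⊆ T → T ⊆ J → f S ≤ f T)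
    (hsub : ∀ S T : Finset ι, S ⊆ J → T ⊆ J → f (S ∪ T) + f (S ∩ T) ≤ f S + f T)
    (OPT : ℝ)
    (hOPT : IsGreatest {t : ℝ | ∃ A : Fin m → Finset ι, IsAllocation J A ∧
      IsLeast (Set.range fun p => f (A p)) t} OPT)
    (hsmall : ∀ j ∈ J, f {j} < (2 / 5) * OPT)
    (A : Fin m → Finset ι) (hA : GreedyOutput f ((2 / 5) * OPT) J m A) :
    ∀ p, (2 / 5) * OPT ≤ f (A p) := by
  obtain ⟨g, hg1, hg2, hrun, hend⟩ := hA
  intro p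
  by_contra hp
  push Not at hp
  obtain ⟨u, hu⟩ : ∃ u, u = OPT / 5 := ⟨_, rfl⟩
  have hτ : (2 / 5) * OPT = 2 * u := by rw [hu]; ring
  rw [hτ] at hsmall hrun hend hp
  have hI : GInv f (2 * u) J g A := by
    clear hend hp
    induction hrun with
    | refl => exact ginv_init hf0 hmono hsmall g hg1
    | tail _ h ih => exact ginv_step hf0 hmono hsub g hg2 ih h
  have hend' : allocSet A = J := hend.resolve_right fun h => absurd (h p) (not_le.2 hp)
  have hAall : IsAllocation J A := by
    refine ⟨hI.sub, hI.disj, fun j hj => ?_⟩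
    rw [← hend'] at hj
    by_contra hcon
    push Not at hcon
    exact not_mem_alloc.2 hcon hj
  obtain ⟨⟨O, hO, hOl⟩, -⟩ := hOPT
  have hO5 : ∀ i, 5 * u ≤ f (O i) := fun i => by
    have := hOl.2 ⟨i, rfl⟩
    simp only at this
    linarith
  have hnn : ∀ S, S ⊆ J → 0 ≤ f S := fun S hS => hf0 ▸ hmono ∅ S (empty_subset _) hS
  have hPJ := hI.sub p
  have hw0 : ∀ j ∈ J, 0 ≤ marg f j (A p) := fun j hj => marg_nonneg hmono hPJ hj
  have hwf : ∀ j ∈ J, marg f j (A p) ≤ f {j} := fun j hj => by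
    have := marg_anti hmono hsub (empty_subset (A p)) hPJ hj
    simpa [marg, hf0] using this
  have hbound := hI.bound p (A p) (subset_refl _) hPJ hp
  have hne : (univ : Finset (Fin m)).Nonempty := ⟨p, mem_univ _⟩
  -- covering of subsets of optimal bundles
  have hcov : ∀ i, ∀ S, S ⊆ O i →
      3 * u - ∑ j ∈ S, f {j} < ∑ j ∈ O i \ S, marg f j (A p) := by
    intro i S hS
    have hOJ := hO.1 i
    have hRJ : O i \ S ⊆ J := sdiff_subset.trans hOJ
    have h1 := sum_marg hmono hsub hPJ (O i \ S) hRJ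
    have h2 := hmono (O i \ S) (A p ∪ (O i \ S)) subset_union_right (union_subset hPJ hRJ)
    have h3 := f_le_sum hf0 hmono hsub S (hS.trans hOJ)
    have h4 := hsub (O i \ S) S hRJ (hS.trans hOJ)
    rw [sdiff_union_of_subset hS, sdiff_inter_self, hf0] at h4
    have h5 := hO5 i
    linarith
  haveI : Nonempty (Fin m) := ⟨p⟩
  obtain ⟨r, hr⟩ := Finite.exists_min (fun q => f {g q})
  obtain ⟨c, hc⟩ : ∃ c, c = f {g r} := ⟨_, rfl⟩
  rcases le_or_gt c u with hcu | hcu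
  · -- all bundles have small total weight
    have h1 : ∀ q, ∑ j ∈ A q, marg f j (A p) ≤ 3 * u := by
      intro q
      rw [← add_sum_erase _ _ (hI.gmem q)]
      have := hbound q
      have := hwf (g q) (hg1 q)
      have := hI.upper q r
      linarith
    have h2 : ∀ i, 3 * u < ∑ j ∈ O i, marg f j (A p) := fun i => by
      simpa using hcov i ∅ (empty_subset _)
    have h3 := sum_lt_sum_of_nonempty hne (fun i _ => h2 i)
    have h4 := sum_le_sum (fun q (_ : q ∈ univ) => h1 q)
    rw [← sum_alloc hO] at h3
    rw [← sum_alloc hAall] at h4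
    linarith
  · have hc2 : c < 2 * u := hc ▸ hsmall _ (hg1 r)
    obtain ⟨x, hx⟩ : ∃ x, x = max 0 (3 * u - 2 * c) := ⟨_, rfl⟩
    have hx0 : 0 ≤ x := hx ▸ le_max_left _ _
    have hx2 : 3 * u - 2 * c ≤ x := hx ▸ le_max_right _ _
    classical
    let big : Fin m → Prop := fun q => ¬ f (A q) < 2 * (2 * u) - f {g q}
    let L : ι → Prop := fun j => (∃ q, g q = j) ∨ ∃ q, big q ∧ j ∈ A q
    let pr : ι → ℝ := fun j => u + min (max (f {j} - c) 0) x
    let φ : ι → ℝ := fun j => if L j then pr j else marg f j (A p)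
    have huniq : ∀ q q' j, j ∈ A q → j ∈ A q' → q = q' := by
      intro q q' j h h'
      by_contra hcon
      exact disjoint_left.1 (hI.disj q q' hcon) h h'
    have hOφ : ∀ i, 2 * u + x ≤ ∑ j ∈ O i, φ j := by
      intro i
      have hsplit : ∑ j ∈ O i, φ j = ∑ j ∈ O i \ (O i).filter L, marg f j (A p)
          + ∑ j ∈ (O i).filter L, pr j := by
        rw [← sum_sdiff (filter_subset L (O i))]
        congr 1
        · refine sum_congr rfl fun j hj => ?_
          simp only [mem_sdiff, mem_filter, not_and] at hj
          exact if_neg (hj.2 hj.1)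
        · refine sum_congr rfl fun j hj => ?_
          exact if_pos (mem_filter.1 hj).2
      rw [hsplit]
      refine opt_core hcu hc2 hx _ (fun j => f {j}) ?_ ?_ ?_
      · intro j hj
        exact hsmall j (hO.1 i (mem_filter.1 hj).1)
      · exact sum_nonneg fun j hj => hw0 j (hO.1 i (mem_sdiff.1 hj).1)
      · exact (hcov i _ (filter_subset _ _)).le
    have hprg : ∀ q, pr (g q) ≤ u + x ∧ pr (g q) ≤ u + (f {g q} - c) := by
      intro q
      have h1 : c ≤ f {g q} := hc ▸ hr q
      constructor
      · simp only [pr]; linarith [min_le_right (max (f {g q} - c) 0) x]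
      · have := min_le_left (max (f {g q} - c) 0) x
        rw [max_eq_left (by linarith)] at this
        simp only [pr]; rw [max_eq_left (by linarith)]; linarith
    have hsm : ∀ q, ¬ big q → ∑ j ∈ A q, φ j < 2 * u + x := by
      intro q hq
      rw [← add_sum_erase _ _ (hI.gmem q)]
      have h1 : φ (g q) = pr (g q) := if_pos (Or.inl ⟨q, rfl⟩)
      have h2 : ∑ j ∈ (A q).erase (g q), φ j = ∑ j ∈ (A q).erase (g q), marg f j (A p) := by
        refine sum_congr rfl fun j hj => if_neg ?_
        obtain ⟨hjg, hjq⟩ := mem_erase.1 hj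
        rintro (⟨q', rfl⟩ | ⟨q', hb, hj'⟩)
        · exact hjg (by rw [huniq q q' _ hjq (hI.gmem q')])
        · exact hq (huniq q q' _ hjq hj' ▸ hb)
      rw [h1, h2]
      have h3 := hbound q
      have h4 : f (A q) < 2 * (2 * u) - f {g q} := not_not.1 hq
      have h5 := (hprg q).2
      have h6 : c ≤ f {g q} := hc ▸ hr q
      linarith
    have hbg : ∀ q, big q → ∑ j ∈ A q, φ j ≤ 2 * u + x := by
      intro q hq
      rcases hI.shape q with h | ⟨k, hk, hkg, -, h | h⟩
      · exfalso
        apply hq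
        rw [h]
        linarith [hsmall _ (hg1 q)]
      · have h1 : φ (g q) = pr (g q) := if_pos (Or.inl ⟨q, rfl⟩)
        have h2 : φ k = pr k := if_pos (Or.inr ⟨q, hq, hk⟩)
        have hkng : ∀ q', g q' ≠ k := by
          rintro q' rfl
          exact hkg (by rw [huniq q q' _ hk (hI.gmem q')])
        have h3 : f {k} ≤ c := hc ▸ hg2 k (hI.sub q hk) hkng r
        have h4 : pr k = u := by
          simp only [pr]; rw [max_eq_right (by linarith), min_eq_left hx0]; ring
        rw [h, sum_pair hkg.symm, h1, h2, h4]
        linarith [(hprg q).1]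
      · exact absurd h hq
    have hlt : ∑ q, ∑ j ∈ A q, φ j < ∑ q : Fin m, (2 * u + x) := by
      refine sum_lt_sum (fun q _ => ?_) ⟨p, mem_univ _, hsm p ?_⟩
      · by_cases hq : big q
        · exact hbg q hq
        · exact (hsm q hq).le
      · refine not_not.2 ?_
        linarith [hsmall _ (hg1 p)]
    have hge := sum_le_sum (fun i (_ : i ∈ univ) => hOφ i)
    rw [← sum_alloc hO] at hge
    rw [← sum_alloc hAall] at hlt
    linarith
end

section
/- Let f be a monotone submodular valuation on a finite item set J with f(∅) = 0, let m ≥ 1 be the number of players, let OPT be the optimal max-min value, and let α > 0. Let B = {j ∈ J : f({j}) ≥ α·OPT} and k = |B|, and assume k ≤ m. Then there exist pairwise disjoint subsets A'_1,…,A'_{m−k} of J∖B such that f(A'_p) ≥ OPT for every p = 1,…,m−k. -/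
open Finset

/-- if `B = {j ∈ J : f({j}) ≥ α·OPT}` has `k ≤ m` elements, then there are
`m − k` pairwise disjoint subsets of `J ∖ B`, each of value at least `OPT`. -/
theorem stmt1 {ι : Type*} [DecidableEq ι] {m : ℕ} (hm : 1 ≤ m)
    (J : Finset ι) (f : Finset ι → ℝ) (hf0 : f ∅ = 0)
    (hmono : ∀ S T : Finset ι, S ⊆ T → T ⊆ J → f S ≤ f T)
    (hsub : ∀ S T : Finset ι, S ⊆ J → T ⊆ J → f (S ∪ T) + f (S ∩ T) ≤ f S + f T)
    (α OPT : ℝ) (hα : 0 < α)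
    (hOPT : IsGreatest {t : ℝ | ∃ A : Fin m → Finset ι, IsAllocation J A ∧
      IsLeast (Set.range fun p => f (A p)) t} OPT)
    (B : Finset ι) (hB : B = J.filter fun j => α * OPT ≤ f {j})
    (hk : B.card ≤ m) :
    ∃ A' : Fin (m - B.card) → Finset ι,
      (∀ p q : Fin (m - B.card), p ≠ q → Disjoint (A' p) (A' q)) ∧
      ∀ p, A' p ⊆ J \ B ∧ OPT ≤ f (A' p) := by
  obtain ⟨⟨A, ⟨hAJ, hdisj, _⟩, hleast⟩, _⟩ := hOPT
  classical
  have hBJ : B ⊆ J := hB ▸ Finset.filter_subset _ _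
  let G : Finset (Fin m) := Finset.univ.filter fun p => Disjoint (A p) B
  have hbad : (Finset.univ.filter fun p : Fin m => ¬ Disjoint (A p) B).card ≤ B.card := by
    have hex : ∀ p : Fin m, ¬ Disjoint (A p) B → ∃ j, j ∈ A p ∧ j ∈ B := fun p hp =>
      Finset.not_disjoint_iff.mp hp
    by_cases hne : Nonempty ι
    · obtain ⟨i0⟩ := hne
      let g : Fin m → ι := fun p => if h : ¬ Disjoint (A p) B then (hex p h).choose else i0
      have hg : ∀ p, ¬ Disjoint (A p) B → g p ∈ A p ∧ g p ∈ B := by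
        intro p hp
        have : g p = (hex p hp).choose := dif_pos hp
        rw [this]
        exact (hex p hp).choose_spec
      apply Finset.card_le_card_of_injOn g
      · intro p hp
        exact (hg p (by simpa using hp)).2
      · intro p hp q hq hpq
        by_contra hne
        have h1 := (hg p (by simpa using hp)).1
        have h2 := (hg q (by simpa using hq)).1
        rw [hpq] at h1
        exact Finset.disjoint_left.mp (hdisj p q hne) h1 h2
    · rw [Finset.card_eq_zero.mpr]
      · exact Nat.zero_le _
      · apply Finset.filter_eq_empty_iff.mpr
        intro p _ hp
        obtain ⟨j, _⟩ := hex p hp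
        exact hne ⟨j⟩
  have hsum : G.card + (Finset.univ.filter fun p : Fin m => ¬ Disjoint (A p) B).card = m := by
    have := Finset.card_filter_add_card_filter_not (s := (Finset.univ : Finset (Fin m)))
      (fun p => Disjoint (A p) B)
    simpa [G] using this
  have hG : m - B.card ≤ G.card := by omega
  let e : Fin (m - B.card) → Fin m := fun p => G.orderEmbOfFin rfl (Fin.castLE hG p)
  have he : ∀ p, Disjoint (A (e p)) B := by
    intro p
    have : e p ∈ G := Finset.orderEmbOfFin_mem G rfl _
    exact (Finset.mem_filter.mp this).2
  refine ⟨fun p => A (e p), fun p q hpq => hdisj _ _ ?_, fun p => ⟨?_, hleast.2 ⟨e p, rfl⟩⟩⟩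
  · intro h
    exact hpq (Fin.castLE_injective hG ((G.orderEmbOfFin rfl).injective h))
  · exact Finset.subset_sdiff.mpr ⟨hAJ _, he p⟩
end

section
/- Let A = (A_1,…,A_m) be any output of Truncated Max-Sum Greedy with threshold τ on an instance with n ≥ m ≥ 1, and suppose some player q satisfies f(A_q) < τ (so in particular every item of J is allocated in A). Then ∑_{j ∈ J} Δ_f(j | A_q) ≤ ∑_{p ≠ q} f(A_p). -/
open Finset

/-- if `A` is a greedy output with threshold `τ` on an instance with
`n ≥ m ≥ 1` and some player `q` still has `f(A q) < τ`, then
`∑_{j ∈ J} Δ_f(j | A_q) ≤ ∑_{p ≠ q} f(A_p)`. -/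
theorem stmt2 {ι : Type*} [DecidableEq ι] {m : ℕ} (hm : 1 ≤ m)
    (J : Finset ι) (hn : m ≤ J.card)
    (f : Finset ι → ℝ) (hf0 : f ∅ = 0)
    (hmono : ∀ S T : Finset ι, S ⊆ T → T ⊆ J → f S ≤ f T)
    (hsub : ∀ S T : Finset ι, S ⊆ J → T ⊆ J → f (S ∪ T) + f (S ∩ T) ≤ f S + f T)
    (τ : ℝ) (A : Fin m → Finset ι) (hA : GreedyOutput f τ J m A)
    (q : Fin m) (hq : f (A q) < τ) :
    ∑ j ∈ J, marg f j (A q) ≤ ∑ p ∈ Finset.univ.erase q, f (A p) := by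
  obtain ⟨g, hgJ, -, hreach, hend⟩ := hA
  have hall : allocSet A = J := by
    rcases hend with h | h
    · exact h
    · exact absurd (h q) (not_le.mpr hq)
  have hQJ : A q ⊆ J := by
    rw [← hall]; exact Finset.le_sup (f := A) (Finset.mem_univ q)
  -- a marginal decreases when the base set grows
  have hmarg : ∀ (j : ι) (S T : Finset ι), j ∈ J → S ⊆ T → T ⊆ J →
      marg f j T ≤ marg f j S := by
    intro j S T hj hST hT
    unfold marg
    by_cases hjT : j ∈ T
    · rw [Finset.insert_eq_of_mem hjT]
      have := hmono S (insert j S) (Finset.subset_insert _ _)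
        (Finset.insert_subset hj (hST.trans hT))
      linarith
    · have h := hsub (insert j S) T (Finset.insert_subset hj (hST.trans hT)) hT
      have h1 : insert j S ∪ T = insert j T := by
        rw [Finset.insert_union, Finset.union_eq_right.mpr hST]
      have h2 : insert j S ∩ T = S := by
        rw [Finset.insert_inter_of_notMem hjT, Finset.inter_eq_left.mpr hST]
      rw [h1, h2] at h
      linarith
  have hzero : ∀ j ∈ A q, marg f j (A q) = 0 := by
    intro j hj
    unfold marg
    rw [Finset.insert_eq_of_mem hj, sub_self]
  have key : ∀ B : Fin m → Finset ι,
      Relation.ReflTransGen (GreedyStep f τ J) (fun p => {g p}) B → B q ⊆ A q →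
      ∑ j ∈ allocSet B, marg f j (A q) ≤ ∑ p ∈ Finset.univ.erase q, f (B p) := by
    intro B hB
    induction hB with
    | refl =>
      intro hsubq
      have h1 : allocSet (fun p => ({g p} : Finset ι)) = Finset.univ.map g := by
        ext x
        simp [allocSet, Finset.mem_sup, eq_comm]
      rw [h1, Finset.sum_map, ← Finset.add_sum_erase _ _ (Finset.mem_univ q),
        hzero (g q) (by simpa using hsubq), zero_add]
      apply Finset.sum_le_sum
      intro p _
      have := hmarg (g p) ∅ (A q) (hgJ p) (Finset.empty_subset _) hQJ
      have h2 : marg f (g p) ∅ = f {g p} := by simp [marg, hf0]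
      rwa [h2] at this
    | @tail B B' _ hstep ih =>
      intro hsubq
      obtain ⟨j, p, hjJ, hjn, -, hmax, rfl⟩ := hstep
      have hBq : B q ⊆ A q := by
        refine Finset.Subset.trans ?_ hsubq
        by_cases hpq : q = p
        · subst hpq; simp
        · simp [Function.update_of_ne hpq]
      have hI := ih hBq
      have h1 : allocSet (Function.update B p (insert j (B p))) = insert j (allocSet B) := by
        ext x
        simp only [allocSet, Finset.mem_sup, Finset.mem_univ, true_and, Finset.mem_insert]
        constructor
        · rintro ⟨r, hr⟩
          by_cases hrp : r = p
          · subst hrp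
            rw [Function.update_self, Finset.mem_insert] at hr
            exact hr.imp id (fun h => ⟨r, h⟩)
          · rw [Function.update_of_ne hrp] at hr
            exact Or.inr ⟨r, hr⟩
        · rintro (h | ⟨r, hr⟩)
          · exact ⟨p, by simp [h]⟩
          · refine ⟨r, ?_⟩
            by_cases hrp : r = p
            · subst hrp; simp [hr]
            · rwa [Function.update_of_ne hrp]
      rw [h1, Finset.sum_insert hjn]
      by_cases hpq : p = q
      · subst hpq
        have hj : j ∈ A p := hsubq (by simp)
        rw [hzero j hj, zero_add]
        refine hI.trans (le_of_eq (Finset.sum_congr rfl ?_))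
        intro r hr
        rw [Function.update_of_ne (Finset.ne_of_mem_erase hr)]
      · have hp : p ∈ Finset.univ.erase q := by simp [hpq]
        have hlt : f (B q) < τ := lt_of_le_of_lt (hmono _ _ hBq hQJ) hq
        have h2 := hmax j hjJ hjn q hlt
        have h3 := hmarg j (B q) (A q) hjJ hBq hQJ
        rw [← Finset.add_sum_erase _ _ hp] at hI ⊢
        have h4 : ∑ r ∈ (Finset.univ.erase q).erase p,
            f (Function.update B p (insert j (B p)) r)
            = ∑ r ∈ (Finset.univ.erase q).erase p, f (B r) := by
          refine Finset.sum_congr rfl ?_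
          intro r hr
          rw [Function.update_of_ne (Finset.ne_of_mem_erase hr)]
        rw [h4, Function.update_self]
        have h5 : marg f j (B p) = f (insert j (B p)) - f (B p) := rfl
        linarith
  have := key A hreach (Finset.Subset.refl _)
  rwa [hall] at this
end

section
/- Let A = (A_1,…,A_m) be any output of Truncated Max-Sum Greedy with threshold τ on an instance with n ≥ m ≥ 1 in which every item j ∈ J satisfies f({j}) ≤ τ. Then f(A_p) ≤ 2τ for every player p. -/
open Finset

/-- if `A` is a greedy output with threshold `τ` on an instance with
`n ≥ m ≥ 1` in which every item has singleton value at most `τ`, then every player's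
bundle has value at most `2τ`. -/
theorem stmt3 {ι : Type*} [DecidableEq ι] {m : ℕ} (hm : 1 ≤ m)
    (J : Finset ι) (hn : m ≤ J.card)
    (f : Finset ι → ℝ) (hf0 : f ∅ = 0)
    (hmono : ∀ S T : Finset ι, S ⊆ T → T ⊆ J → f S ≤ f T)
    (hsub : ∀ S T : Finset ι, S ⊆ J → T ⊆ J → f (S ∪ T) + f (S ∩ T) ≤ f S + f T)
    (τ : ℝ) (hsmall : ∀ j ∈ J, f {j} ≤ τ)
    (A : Fin m → Finset ι) (hA : GreedyOutput f τ J m A) :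
    ∀ p, f (A p) ≤ 2 * τ := by
  obtain ⟨g, hgJ, -, hreach, -⟩ := hA
  have key : ∀ B : Fin m → Finset ι,
      Relation.ReflTransGen (GreedyStep f τ J) (fun p => {g p}) B →
      ∀ p, B p ⊆ J ∧ f (B p) ≤ 2 * τ := by
    intro B hB
    induction hB with
    | refl =>
      intro p
      have h1 : ({g p} : Finset ι) ⊆ J := Finset.singleton_subset_iff.2 (hgJ p)
      have h2 := hmono ∅ {g p} (Finset.empty_subset _) h1
      have h3 := hsmall _ (hgJ p)
      exact ⟨h1, by show f {g p} ≤ 2 * τ; linarith⟩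
    | tail _ hstep ih =>
      rename_i B C _
      obtain ⟨j, q, hj, hjB, hq, -, rfl⟩ := hstep
      intro p
      by_cases hpq : p = q
      · subst hpq
        rw [Function.update_self]
        have h1 : ({j} : Finset ι) ⊆ J := Finset.singleton_subset_iff.2 hj
        have hnot : j ∉ B p := fun h =>
          hjB (Finset.le_sup (f := B) (Finset.mem_univ p) h)
        have h2 := hsub {j} (B p) h1 (ih p).1
        rw [Finset.singleton_inter_of_notMem hnot, hf0, Finset.singleton_union] at h2
        have h3 := hsmall j hj
        exact ⟨Finset.insert_subset hj (ih p).1, by linarith⟩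
      · rw [Function.update_of_ne hpq]
        exact ih p
  exact fun p => (key A hreach p).2
end

section
/- Let P be a finite set of players, q ∈ P, and let (A_p)_{p∈P} and (A*_p)_{p∈P} be two families of finite sets of items, each family pairwise disjoint, with ∪_{p∈P} A_p ⊆ ∪_{p∈P} A*_p and A_q ≠ ∅. Suppose that for every integer k ≥ 1, every k distinct players p_1,…,p_k ∈ P∖{q}, and every k distinct players r_1,…,r_k ∈ P, the set A_{p_1} ∪ … ∪ A_{p_k} is NOT a subset of A*_{r_1} ∪ … ∪ A*_{r_k}. Then there exists a permutation φ of P such that A_p ∩ A*_{φ(p)} ≠ ∅ for every p ∈ P. -/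
open Finset

/-- given two pairwise-disjoint families `(A_p)` and `(A*_p)` over a finite
player set `P`, with `∪_p A_p ⊆ ∪_p A*_p` and `A_q ≠ ∅`, such that no union of the `A_p`'s
over `k ≥ 1` players avoiding `q` is contained in a union of the `A*_r`'s over `k` players,
there is a permutation `φ` of `P` with `A_p ∩ A*_{φ(p)} ≠ ∅` for all `p`. -/
theorem stmt8 {P ι : Type*} [Fintype P] [DecidableEq P] [DecidableEq ι]
    (q : P) (A Astar : P → Finset ι)
    (hA : ∀ p p' : P, p ≠ p' → Disjoint (A p) (A p'))
    (hAstar : ∀ p p' : P, p ≠ p' → Disjoint (Astar p) (Astar p'))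
    (hcover : Finset.univ.sup A ⊆ Finset.univ.sup Astar)
    (hq : A q ≠ ∅)
    (hno : ∀ Q R : Finset P, Q.Nonempty → q ∉ Q → R.card = Q.card →
      ¬ (Q.sup A ⊆ R.sup Astar)) :
    ∃ φ : Equiv.Perm P, ∀ p, (A p ∩ Astar (φ p)).Nonempty := by
  classical
  let N : P → Finset P := fun p => Finset.univ.filter fun r => (A p ∩ Astar r).Nonempty
  -- every item of `A p` lies in some `Astar r` with `r ∈ N p`
  have key : ∀ p, ∀ x ∈ A p, ∃ r ∈ N p, x ∈ Astar r := by
    intro p x hx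
    have h1 : x ∈ Finset.univ.sup A := Finset.mem_sup.2 ⟨p, Finset.mem_univ _, hx⟩
    obtain ⟨r, -, hr⟩ := Finset.mem_sup.1 (hcover h1)
    exact ⟨r, Finset.mem_filter.2 ⟨Finset.mem_univ _, x, Finset.mem_inter.2 ⟨hx, hr⟩⟩, hr⟩
  have big : ∀ Q : Finset P, Q.Nonempty → q ∉ Q → Q.card < (Q.biUnion N).card := by
    intro Q hQ hqQ
    by_contra! hle
    obtain ⟨R, hR, hcard⟩ := Finset.exists_superset_card_eq hle (Finset.card_le_univ Q)
    refine hno Q R hQ hqQ hcard ?_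
    intro x hx
    obtain ⟨p, hp, hxp⟩ := Finset.mem_sup.1 hx
    obtain ⟨r, hr, hxr⟩ := key p x hxp
    exact Finset.mem_sup.2 ⟨r, hR (Finset.mem_biUnion.2 ⟨p, hp, hr⟩), hxr⟩
  have hall : ∀ S : Finset P, S.card ≤ (S.biUnion N).card := by
    intro S
    by_cases hqS : q ∈ S
    · have hc := Finset.card_erase_add_one hqS
      rcases (S.erase q).eq_empty_or_nonempty with he | hne
      · rw [he, Finset.card_empty] at hc
        obtain ⟨x, hx⟩ := Finset.nonempty_iff_ne_empty.2 hq
        obtain ⟨r, hr, -⟩ := key q x hx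
        have : 0 < (S.biUnion N).card :=
          Finset.card_pos.2 ⟨r, Finset.mem_biUnion.2 ⟨q, hqS, hr⟩⟩
        omega
      · have h1 := big _ hne (Finset.notMem_erase q S)
        have h2 : ((S.erase q).biUnion N).card ≤ (S.biUnion N).card :=
          Finset.card_le_card (Finset.biUnion_subset_biUnion_of_subset_left N
            (Finset.erase_subset q S))
        omega
    · rcases S.eq_empty_or_nonempty with rfl | hne
      · simp
      · exact (big S hne hqS).le
  obtain ⟨f, hf, hfN⟩ := (Finset.all_card_le_biUnion_card_iff_exists_injective N).1 hall
  refine ⟨Equiv.ofBijective f (Finite.injective_iff_bijective.1 hf), fun p => ?_⟩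
  exact (Finset.mem_filter.1 (hfN p)).2
end

section
/- Let A = (A_1,…,A_m) be any output of Truncated Max-Sum Greedy with threshold τ > 0 on an instance with n ≥ m ≥ 1, and suppose some player q satisfies f(A_q) < τ. Then for every player p and every item k ∈ A_p, ∑_{j ∈ A_p∖{k}} Δ_f(j | A_q) < τ. -/
open Finset

theorem marg_anti_aux {ι : Type*} [DecidableEq ι] (J : Finset ι) (f : Finset ι → ℝ)
    (hmono : ∀ S T : Finset ι, S ⊆ T → T ⊆ J → f S ≤ f T)
    (hsub : ∀ S T : Finset ι, S ⊆ J → T ⊆ J → f (S ∪ T) + f (S ∩ T) ≤ f S + f T)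
    (S T : Finset ι) (hST : S ⊆ T) (hT : T ⊆ J) (j : ι) (hj : j ∈ J) :
    marg f j T ≤ marg f j S := by
  unfold marg
  by_cases h : j ∈ T
  · rw [Finset.insert_eq_of_mem h]
    have := hmono S (insert j S) (Finset.subset_insert _ _)
      (Finset.insert_subset hj (hST.trans hT))
    linarith
  · have h1 := hsub (insert j S) T (Finset.insert_subset hj (hST.trans hT)) hT
    have h2 : insert j S ∪ T = insert j T := by
      rw [Finset.insert_union, Finset.union_eq_right.2 hST]
    have h3 : insert j S ∩ T = S := by
      rw [Finset.insert_inter_of_notMem h, Finset.inter_eq_left.2 hST]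
    rw [h2, h3] at h1
    linarith

theorem mem_allocSet_aux {ι : Type*} [DecidableEq ι] {m : ℕ} (A : Fin m → Finset ι) (j : ι) :
    j ∈ allocSet A ↔ ∃ p, j ∈ A p := by
  simp [allocSet, Finset.mem_sup]

/-- The invariant maintained by the greedy procedure. -/
def GInv_s9 {ι : Type*} [DecidableEq ι] {m : ℕ} (f : Finset ι → ℝ) (τ : ℝ)
    (J : Finset ι) (B : Fin m → Finset ι) : Prop :=
  (∀ p, B p ⊆ J) ∧ ∀ q, f (B q) < τ → ∀ p,
    (∑ j ∈ B p, marg f j (B q) ≤ f (B p)) ∧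
    (∀ k ∈ B p, ∀ x ∈ J, x ∉ allocSet B →
      ∑ j ∈ (B p).erase k, marg f j (B q) + marg f x (B q) ≤ f (B p)) ∧
    (∀ k ∈ B p, ∑ j ∈ (B p).erase k, marg f j (B q) < τ)

theorem GInv_step {ι : Type*} [DecidableEq ι] {m : ℕ} (J : Finset ι) (f : Finset ι → ℝ)
    (hmono : ∀ S T : Finset ι, S ⊆ T → T ⊆ J → f S ≤ f T)
    (hsub : ∀ S T : Finset ι, S ⊆ J → T ⊆ J → f (S ∪ T) + f (S ∩ T) ≤ f S + f T)
    (τ : ℝ) (B B' : Fin m → Finset ι) (hB : GInv_s9 f τ J B) (hs : GreedyStep f τ J B B') :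
    GInv_s9 f τ J B' := by
  obtain ⟨hJ, hI⟩ := hB
  obtain ⟨y, r, hyJ, hy, hr, hmax, hB'⟩ := hs
  have hBr : B' r = insert y (B r) := by simp [hB']
  have hBn : ∀ p, p ≠ r → B' p = B p := fun p hp => by simp [hB', hp]
  have hle : ∀ p, B p ⊆ B' p := by
    intro p
    by_cases hp : p = r
    · subst hp; rw [hBr]; exact Finset.subset_insert _ _
    · rw [hBn p hp]
  have hJ' : ∀ p, B' p ⊆ J := by
    intro p
    by_cases hp : p = r
    · subst hp; rw [hBr]; exact Finset.insert_subset hyJ (hJ p)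
    · rw [hBn p hp]; exact hJ p
  have hyr : y ∉ B r := fun h => hy ((mem_allocSet_aux B y).2 ⟨r, h⟩)
  refine ⟨hJ', fun q hq p => ?_⟩
  have hq0 : f (B q) < τ := lt_of_le_of_lt (hmono _ _ (hle q) (hJ' q)) hq
  have hanti : ∀ j ∈ J, marg f j (B' q) ≤ marg f j (B q) := fun j hj =>
    marg_anti_aux J f hmono hsub _ _ (hle q) (hJ' q) j hj
  have hsum : ∀ S : Finset ι, S ⊆ J →
      ∑ j ∈ S, marg f j (B' q) ≤ ∑ j ∈ S, marg f j (B q) := fun S hS =>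
    Finset.sum_le_sum fun j hj => hanti j (hS hj)
  have hsumE : ∀ k, ∑ j ∈ (B p).erase k, marg f j (B' q) ≤
      ∑ j ∈ (B p).erase k, marg f j (B q) := fun k =>
    hsum _ ((Finset.erase_subset _ _).trans (hJ p))
  have hal : ∀ x, x ∉ allocSet B' → x ∉ allocSet B := by
    intro x hx h
    obtain ⟨s, hs⟩ := (mem_allocSet_aux B x).1 h
    exact hx ((mem_allocSet_aux B' x).2 ⟨s, hle s hs⟩)
  obtain ⟨ha, hb, hc⟩ := hI q hq0 p
  have hsp := hsum _ (hJ p)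
  by_cases hp : p = r
  · subst hp
    have hfy : f (B' p) = f (B p) + marg f y (B p) := by rw [hBr]; unfold marg; ring
    have hyq := hmax y hyJ hy q hq0
    have hay := hanti y hyJ
    rw [hfy, hBr]
    have her : ∀ k ∈ B p, ∑ j ∈ (insert y (B p)).erase k, marg f j (B' q) =
        marg f y (B' q) + ∑ j ∈ (B p).erase k, marg f j (B' q) := by
      intro k hk
      have hne : y ≠ k := fun h => hyr (h ▸ hk)
      rw [Finset.erase_insert_of_ne hne, Finset.sum_insert]
      exact fun h => hyr (Finset.mem_of_mem_erase h)
    refine ⟨?_, ?_, ?_⟩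
    · rw [Finset.sum_insert hyr]; linarith
    · intro k hk x hx hxa
      have hxq := hmax x hx (hal x hxa) q hq0
      have hax := hanti x hx
      rcases Finset.mem_insert.1 hk with h | h
      · subst h
        rw [Finset.erase_insert hyr]; linarith
      · rw [her k h]
        have := hb k h y hyJ hy
        have := hsumE k
        linarith
    · intro k hk
      rcases Finset.mem_insert.1 hk with h | h
      · subst h
        rw [Finset.erase_insert hyr]; linarith
      · rw [her k h]
        have := hb k h y hyJ hy
        have := hsumE k
        linarith
  · rw [hBn p hp]
    refine ⟨by linarith, ?_, ?_⟩
    · intro k hk x hx hxa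
      have := hb k hk x hx (hal x hxa)
      have := hsumE k
      have := hanti x hx
      linarith
    · intro k hk
      have := hc k hk
      have := hsumE k
      linarith

/-- if `A` is a greedy output with threshold `τ > 0` on an instance with
`n ≥ m ≥ 1` and some player `q` satisfies `f(A q) < τ`, then for every player `p` and every
item `k ∈ A p`, `∑_{j ∈ A_p ∖ {k}} Δ_f(j | A_q) < τ`. -/
theorem stmt9 {ι : Type*} [DecidableEq ι] {m : ℕ} (hm : 1 ≤ m)
    (J : Finset ι) (hn : m ≤ J.card)
    (f : Finset ι → ℝ) (hf0 : f ∅ = 0)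
    (hmono : ∀ S T : Finset ι, S ⊆ T → T ⊆ J → f S ≤ f T)
    (hsub : ∀ S T : Finset ι, S ⊆ J → T ⊆ J → f (S ∪ T) + f (S ∩ T) ≤ f S + f T)
    (τ : ℝ) (hτ : 0 < τ)
    (A : Fin m → Finset ι) (hA : GreedyOutput f τ J m A)
    (q : Fin m) (hq : f (A q) < τ) :
    ∀ p : Fin m, ∀ k ∈ A p, ∑ j ∈ (A p).erase k, marg f j (A q) < τ := by
  obtain ⟨g, hgJ, hg, hrun, -⟩ := hA
  have key : GInv_s9 f τ J A := by
    clear hq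
    induction hrun with
    | refl =>
      have hm1 : ∀ (q : Fin m), ∀ x ∈ J, marg f x {g q} ≤ f {x} := by
        intro q x hx
        have := marg_anti_aux J f hmono hsub ∅ {g q} (Finset.empty_subset _)
          (Finset.singleton_subset_iff.2 (hgJ q)) x hx
        simpa [marg, hf0] using this
      refine ⟨fun p => Finset.singleton_subset_iff.2 (hgJ p), fun q _ p => ⟨?_, ?_, ?_⟩⟩
      · simpa using hm1 q (g p) (hgJ p)
      · intro k hk x hx hxa
        rw [Finset.mem_singleton] at hk
        subst hk
        have h1 := hg x hx (fun s h => hxa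
          ((mem_allocSet_aux _ x).2 ⟨s, by simp [h]⟩)) p
        have h2 := hm1 q x hx
        simpa using h2.trans h1
      · intro k hk
        rw [Finset.mem_singleton] at hk
        subst hk
        simpa using hτ
    | tail _ hs ih => exact GInv_step J f hmono hsub τ _ _ ih hs
  exact fun p => (key.2 q hq p).2.2
end

section
/- Let f be a monotone submodular valuation with f(∅) = 0 on a finite item set, and let A_q, A_p, A*_p be finite sets of items with f(A*_p) ≥ 5, f(A_q) ≤ 2, and ∑_{j ∈ A_p} Δ_f(j | A_q) ≤ f(A_p). Define W_p = A_p ∖ A*_p and V_p = A*_p ∖ A_p. Then ∑_{j ∈ V_p} Δ_f(j | A_q) ≥ 3 + ∑_{j ∈ W_p} Δ_f(j | A_q) − f(A_p). -/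
open Finset

theorem sum_marg_ge {ι : Type*} [DecidableEq ι]
    (f : Finset ι → ℝ)
    (hmono : ∀ S T : Finset ι, S ⊆ T → f S ≤ f T)
    (hsub : ∀ S T : Finset ι, f (S ∪ T) + f (S ∩ T) ≤ f S + f T)
    (A B : Finset ι) : f (B ∪ A) - f A ≤ ∑ j ∈ B, marg f j A := by
  induction B using Finset.induction_on with
  | empty => simp
  | insert j B hj ih =>
    rw [Finset.sum_insert hj]
    have h1 := hsub (insert j A) (B ∪ A)
    have h2 : insert j A ∪ (B ∪ A) = insert j B ∪ A := by
      ext x; simp only [Finset.mem_union, Finset.mem_insert]; tauto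
    have h3 := hmono A (insert j A ∩ (B ∪ A)) (by
      intro x hx; simp [hx])
    rw [h2] at h1
    have h4 : marg f j A = f (insert j A) - f A := rfl
    linarith

/-- for a monotone submodular `f` with `f(∅) = 0` and sets with
`f(A*_p) ≥ 5`, `f(A_q) ≤ 2` and `∑_{j ∈ A_p} Δ_f(j | A_q) ≤ f(A_p)`, setting
`W_p = A_p ∖ A*_p` and `V_p = A*_p ∖ A_p` we have
`∑_{j ∈ V_p} Δ_f(j | A_q) ≥ 3 + ∑_{j ∈ W_p} Δ_f(j | A_q) − f(A_p)`. -/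
theorem stmt10 {ι : Type*} [DecidableEq ι] [Fintype ι]
    (f : Finset ι → ℝ) (hf0 : f ∅ = 0)
    (hmono : ∀ S T : Finset ι, S ⊆ T → f S ≤ f T)
    (hsub : ∀ S T : Finset ι, f (S ∪ T) + f (S ∩ T) ≤ f S + f T)
    (Aq Ap Astarp : Finset ι)
    (h5 : 5 ≤ f Astarp) (h2 : f Aq ≤ 2)
    (hΔ : ∑ j ∈ Ap, marg f j Aq ≤ f Ap) :
    3 + ∑ j ∈ Ap \ Astarp, marg f j Aq - f Ap ≤ ∑ j ∈ Astarp \ Ap, marg f j Aq := by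
  have h := sum_marg_ge f hmono hsub Aq Astarp
  have hm := hmono Astarp (Astarp ∪ Aq) Finset.subset_union_left
  have e1 := Finset.sum_inter_add_sum_sdiff Ap Astarp (fun j => marg f j Aq)
  have e2 := Finset.sum_inter_add_sum_sdiff Astarp Ap (fun j => marg f j Aq)
  rw [Finset.inter_comm] at e2
  linarith
end

section
/- Let f be a monotone valuation with f(∅) = 0 on a finite item set J, let m ≥ 1, and let T ∈ ℝ. Suppose there exists y : J → ℝ_{≥0} with ∑_{j∈J} y_j ≤ m and ∑_{j∈S} y_j ≥ 1 for every S ⊆ J with f(S) ≥ T, and suppose there exists an item j* ∈ J such that ∑_{j∈S} y_j > 1 for every S ⊆ J with f(S) ≥ T and j* ∈ S. Then there exists y' : J → ℝ_{≥0} with ∑_{j∈J} y'_j < m and ∑_{j∈S} y'_j ≥ 1 for every S ⊆ J with f(S) ≥ T. -/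
open Finset

/-- if a nonnegative `y` with `∑_{j∈J} y_j ≤ m` hits every configuration
(`∑_{j∈S} y_j ≥ 1` whenever `S ⊆ J` and `f(S) ≥ T`), and some item `j*` lies only in
configurations that are hit strictly, then there is a nonnegative `y'` with
`∑_{j∈J} y'_j < m` still hitting every configuration. -/
theorem stmt12 {ι : Type*} [DecidableEq ι] (J : Finset ι) (f : Finset ι → ℝ)
    (hf0 : f ∅ = 0)
    (hmono : ∀ S T : Finset ι, S ⊆ T → T ⊆ J → f S ≤ f T)
    {m : ℕ} (hm : 1 ≤ m) (T : ℝ)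
    (y : ι → ℝ) (hy0 : ∀ j, 0 ≤ y j)
    (hysum : ∑ j ∈ J, y j ≤ (m : ℝ))
    (hyhit : ∀ S ⊆ J, T ≤ f S → 1 ≤ ∑ j ∈ S, y j)
    (jstar : ι) (hjstar : jstar ∈ J)
    (hstrict : ∀ S ⊆ J, T ≤ f S → jstar ∈ S → 1 < ∑ j ∈ S, y j) :
    ∃ y' : ι → ℝ, (∀ j, 0 ≤ y' j) ∧ ∑ j ∈ J, y' j < (m : ℝ) ∧
      ∀ S ⊆ J, T ≤ f S → 1 ≤ ∑ j ∈ S, y' j := by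
  by_cases hlt : ∑ j ∈ J, y j < (m : ℝ)
  · exact ⟨y, hy0, hlt, hyhit⟩
  have hm' : (1 : ℝ) ≤ m := by exact_mod_cast hm
  -- an item of positive weight all of whose configurations are strictly hit
  have key : ∃ k ∈ J, 0 < y k ∧ ∀ S ⊆ J, T ≤ f S → k ∈ S → 1 < ∑ j ∈ S, y j := by
    rcases (hy0 jstar).lt_or_eq with h | h
    · exact ⟨jstar, hjstar, h, hstrict⟩
    · have hpos : 0 < ∑ j ∈ J, y j := by linarith
      obtain ⟨k, hk, hk0⟩ : ∃ k ∈ J, 0 < y k := by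
        by_contra! hcon
        exact absurd (Finset.sum_nonpos hcon) (not_le.mpr hpos)
      refine ⟨k, hk, hk0, fun S hS hT _ => ?_⟩
      by_cases hj : jstar ∈ S
      · exact hstrict S hS hT hj
      · have hsub : insert jstar S ⊆ J := Finset.insert_subset hjstar hS
        have h1 := hstrict (insert jstar S) hsub
          (hT.trans (hmono _ _ (Finset.subset_insert _ _) hsub)) (Finset.mem_insert_self _ _)
        rw [Finset.sum_insert hj, ← h, zero_add] at h1
        exact h1
  obtain ⟨k, hk, hk0, hks⟩ := key
  have heps : ∃ e : ℝ, 0 < e ∧ e ≤ y k ∧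
      ∀ S ⊆ J, T ≤ f S → k ∈ S → 1 + e ≤ ∑ j ∈ S, y j := by
    classical
    let C := J.powerset.filter (fun S => T ≤ f S ∧ k ∈ S)
    by_cases hC : C.Nonempty
    · obtain ⟨S₀, hS₀, hmin⟩ := Finset.exists_min_image C (fun S => ∑ j ∈ S, y j) hC
      simp only [C, Finset.mem_filter, Finset.mem_powerset] at hS₀ hmin
      have h0 := hks S₀ hS₀.1 hS₀.2.1 hS₀.2.2
      refine ⟨min (y k) (∑ j ∈ S₀, y j - 1), lt_min hk0 (by linarith), min_le_left _ _, ?_⟩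
      intro S hS hT hkS
      have h1 := hmin S ⟨hS, hT, hkS⟩
      have h2 := min_le_right (y k) (∑ j ∈ S₀, y j - 1)
      linarith
    · refine ⟨y k, hk0, le_rfl, fun S hS hT hkS => (hC ⟨S, ?_⟩).elim⟩
      simp only [C, Finset.mem_filter, Finset.mem_powerset]
      exact ⟨hS, hT, hkS⟩
  obtain ⟨e, he0, hey, heS⟩ := heps
  have hsum : ∀ S : Finset ι, ∑ j ∈ S, (y j - if j = k then e else 0) =
      ∑ j ∈ S, y j - if k ∈ S then e else 0 := by
    intro S
    rw [Finset.sum_sub_distrib, Finset.sum_ite_eq']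
  refine ⟨fun j => y j - if j = k then e else 0, fun j => ?_, ?_, fun S hS hT => ?_⟩
  · dsimp only
    split_ifs with h
    · subst h; linarith
    · simpa using hy0 j
  · rw [hsum, if_pos hk]; linarith
  · rw [hsum]
    split_ifs with h
    · linarith [heS S hS hT h]
    · simpa using hyhit S hS hT
end

section
/- Let f be a monotone submodular valuation with f(∅) = 0 on a finite item set J, let m ≥ 2, and let OPT_m(J) denote the maximum over partitions of J into m parts (A_1,…,A_m) of min_p f(A_p). Suppose j ∈ J satisfies f({j}) > OPT_m(J). Then: (a) OPT_{m−1}(J∖{j}) ≤ OPT_m(J), where OPT_{m−1}(J∖{j}) is the analogous optimum with m−1 players and item set J∖{j}; and (b) for every threshold T, if the configuration LP at threshold T with m players and item set J is feasible, then the configuration LP at threshold T with m−1 players and item set J∖{j} is feasible. -/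
open Finset

open scoped Classical in
/-- The configuration LP at threshold `T` for `m` players with identical valuation `f` on
items `J` is feasible: there is `x ≥ 0` indexed by players and configurations
`C ∈ C(T) = {S ⊆ J : f(S) ≥ T}` with `∑_{C ∈ C(T)} x_{p,C} ≥ 1` for every player `p` and
`∑_p ∑_{C ∈ C(T), j ∈ C} x_{p,C} ≤ 1` for every item `j ∈ J`. -/
def ConfigLPFeasible {ι : Type*} (f : Finset ι → ℝ) (J : Finset ι) (m : ℕ) (T : ℝ) : Prop :=
  ∃ x : Fin m → Finset ι → ℝ,
    (∀ p C, 0 ≤ x p C) ∧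
    (∀ p : Fin m, 1 ≤ ∑ C ∈ J.powerset.filter (fun C => T ≤ f C), x p C) ∧
    (∀ j ∈ J, ∑ p : Fin m, ∑ C ∈ J.powerset.filter (fun C => T ≤ f C ∧ j ∈ C), x p C ≤ 1)

/-- if `f({j}) > OPT_m(J)`, then (a) removing item `j` and one player does not
increase the integral optimum, and (b) feasibility of the configuration LP at any threshold
`T` is preserved when removing item `j` and one player. -/
theorem stmt13 {ι : Type*} [DecidableEq ι] (J : Finset ι) (f : Finset ι → ℝ)
    (hf0 : f ∅ = 0)
    (hmono : ∀ S T : Finset ι, S ⊆ T → T ⊆ J → f S ≤ f T)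
    (hsub : ∀ S T : Finset ι, S ⊆ J → T ⊆ J → f (S ∪ T) + f (S ∩ T) ≤ f S + f T)
    {m : ℕ} (hm : 2 ≤ m)
    (OPT OPT' : ℝ)
    (hOPT : IsGreatest {t : ℝ | ∃ A : Fin m → Finset ι, IsAllocation J A ∧
      IsLeast (Set.range fun p => f (A p)) t} OPT)
    (j : ι) (hj : j ∈ J) (hbig : OPT < f {j})
    (hOPT' : IsGreatest {t : ℝ | ∃ A : Fin (m - 1) → Finset ι, IsAllocation (J.erase j) A ∧
      IsLeast (Set.range fun p => f (A p)) t} OPT') :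
    OPT' ≤ OPT ∧
    ∀ T : ℝ, ConfigLPFeasible f J m T → ConfigLPFeasible f (J.erase j) (m - 1) T := by
  obtain ⟨n, rfl⟩ : ∃ n, m = n + 1 := ⟨m - 1, by omega⟩
  have hn : 1 ≤ n := by omega
  change IsGreatest {t : ℝ | ∃ A : Fin n → Finset ι, IsAllocation (J.erase j) A ∧
      IsLeast (Set.range fun p => f (A p)) t} OPT' at hOPT'
  change OPT' ≤ OPT ∧
    ∀ T : ℝ, ConfigLPFeasible f J (n + 1) T → ConfigLPFeasible f (J.erase j) n T
  constructor
  · by_contra hlt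
    push Not at hlt
    obtain ⟨⟨A, ⟨hA1, hA2, hA3⟩, -, hAle⟩, -⟩ := hOPT'
    have hjA : ∀ p, j ∉ A p := fun p h => by simpa using hA1 p h
    let B : Fin (n + 1) → Finset ι := Fin.cons {j} A
    have hB0 : B 0 = {j} := rfl
    have hBs : ∀ p : Fin n, B p.succ = A p := fun p => rfl
    have hB : IsAllocation J B := by
      refine ⟨?_, ?_, ?_⟩
      · intro p
        refine Fin.cases ?_ (fun q => ?_) p
        · rw [hB0]; simpa using hj
        · rw [hBs]; exact (hA1 q).trans (Finset.erase_subset _ _)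
      · intro p q
        refine Fin.cases ?_ (fun p => ?_) p <;> refine Fin.cases ?_ (fun q => ?_) q
        · intro h; exact absurd rfl h
        · intro _; rw [hB0, hBs]; simpa using hjA q
        · intro _; rw [hB0, hBs]; simpa using hjA p
        · intro h; rw [hBs, hBs]; exact hA2 p q (fun e => h (by rw [e]))
      · intro i hi
        by_cases h : i = j
        · exact ⟨0, by rw [hB0]; simpa using h⟩
        · obtain ⟨p, hp⟩ := hA3 i (Finset.mem_erase.2 ⟨h, hi⟩)
          exact ⟨p.succ, by rw [hBs]; exact hp⟩
    obtain ⟨p0, hp0⟩ := Finite.exists_min (fun p => f (B p))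
    have hle : f (B p0) ≤ OPT := by
      refine hOPT.2 ⟨B, hB, ⟨p0, rfl⟩, ?_⟩
      rintro _ ⟨q, rfl⟩
      exact hp0 q
    have hgt : ∀ p, OPT < f (B p) := by
      intro p
      refine Fin.cases ?_ (fun q => ?_) p
      · rw [hB0]; exact hbig
      · rw [hBs]; exact lt_of_lt_of_le hlt (hAle ⟨q, rfl⟩)
    exact absurd hle (not_le.2 (hgt p0))
  · rintro T ⟨x, hx0, hx1, hx2⟩
    classical
    have hnpos : (0 : ℝ) < n := by exact_mod_cast hn
    have hy0 : ∀ C, 0 ≤ ∑ q, x q C := fun C => Finset.sum_nonneg fun q _ => hx0 q C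
    refine ⟨fun _ C => (∑ q, x q C) / n, fun _ C => div_nonneg (hy0 C) hnpos.le, ?_, ?_⟩
    · intro _
      rw [← Finset.sum_div, le_div_iff₀ hnpos, one_mul]
      have h1 : ((n : ℝ) + 1) ≤
          ∑ C ∈ J.powerset.filter (fun C => T ≤ f C), ∑ q, x q C := by
        rw [Finset.sum_comm]
        calc ((n : ℝ) + 1) = ∑ q : Fin (n + 1), (1 : ℝ) := by simp
          _ ≤ _ := Finset.sum_le_sum fun q _ => by convert hx1 q
      have h2 : ∑ C ∈ J.powerset.filter (fun C => T ≤ f C ∧ j ∈ C), ∑ q, x q C ≤ 1 := by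
        rw [Finset.sum_comm]
        convert hx2 j hj
      have h3 := Finset.sum_filter_add_sum_filter_not
        (J.powerset.filter (fun C => T ≤ f C)) (fun C => j ∈ C) (fun C => ∑ q, x q C)
      rw [Finset.filter_filter, Finset.filter_filter] at h3
      have h4 : J.powerset.filter (fun C => T ≤ f C ∧ j ∉ C)
          = (J.erase j).powerset.filter (fun C => T ≤ f C) := by
        ext C
        simp only [Finset.mem_filter, Finset.mem_powerset, Finset.subset_erase]
        tauto
      rw [h4] at h3
      have h5 : (n : ℝ) ≤
          ∑ C ∈ (J.erase j).powerset.filter (fun C => T ≤ f C), ∑ q, x q C := by linarith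
      convert h5
    · intro i hi
      have hiJ := Finset.mem_of_mem_erase hi
      have h2 : ∑ C ∈ J.powerset.filter (fun C => T ≤ f C ∧ i ∈ C), ∑ q, x q C ≤ 1 := by
        rw [Finset.sum_comm]
        convert hx2 i hiJ
      have h3 : ∑ C ∈ (J.erase j).powerset.filter (fun C => T ≤ f C ∧ i ∈ C), ∑ q, x q C
          ≤ ∑ C ∈ J.powerset.filter (fun C => T ≤ f C ∧ i ∈ C), ∑ q, x q C :=
        Finset.sum_le_sum_of_subset_of_nonneg
          (Finset.filter_subset_filter _ (Finset.powerset_mono.2 (Finset.erase_subset _ _)))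
          (fun C _ _ => hy0 C)
      rw [Finset.sum_const, ← Finset.sum_div, Finset.card_univ, Fintype.card_fin, nsmul_eq_mul,
        mul_div_cancel₀ _ hnpos.ne']
      have h4 := h3.trans h2
      refine le_trans (le_of_eq ?_) h4
      congr!
end

section
/- Let f be a monotone submodular valuation with f(∅) = 0 on a finite item set J, let m ≥ 1 be the number of players, and let OPT be the maximum over partitions of J into m parts (A_1,…,A_m) of min_p f(A_p). Then for every threshold T > 3·OPT, the configuration LP at threshold T is infeasible. (In particular, the integrality gap of the configuration LP with identical submodular valuations is at most 3.) -/
open Finset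

lemma gain_aux {ι : Type*} [DecidableEq ι] (J : Finset ι) (h : Finset ι → ℝ)
    (hsub : ∀ S T : Finset ι, S ⊆ J → T ⊆ J → h (S ∪ T) + h (S ∩ T) ≤ h S + h T)
    (hmono : ∀ S T : Finset ι, S ⊆ T → T ⊆ J → h S ≤ h T)
    (A : Finset ι) (hA : A ⊆ J) (C : Finset ι) :
    C ⊆ J → h (A ∪ C) - h A ≤ ∑ j ∈ C, (h (insert j A) - h A) := by
  induction C using Finset.induction_on with
  | empty => intro _; simp
  | insert c C hc ih =>
    intro hC
    have hcJ : c ∈ J := hC (mem_insert_self _ _)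
    have hCJ : C ⊆ J := fun x hx => hC (mem_insert_of_mem hx)
    have ih' := ih hCJ
    rw [Finset.sum_insert hc]
    have hi : insert c A ⊆ J := insert_subset hcJ hA
    have hu : A ∪ C ⊆ J := union_subset hA hCJ
    have h1 := hsub (A ∪ C) (insert c A) hu hi
    have e1 : (A ∪ C) ∪ insert c A = A ∪ insert c C := by ext x; simp; tauto
    have h2 := hmono A ((A ∪ C) ∩ insert c A)
      (fun x hx => by simp [hx]) (inter_subset_left.trans hu)
    rw [e1] at h1
    linarith

lemma loss_aux {ι : Type*} [DecidableEq ι] (J : Finset ι) (h : Finset ι → ℝ)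
    (hsub : ∀ S T : Finset ι, S ⊆ J → T ⊆ J → h (S ∪ T) + h (S ∩ T) ≤ h S + h T)
    (A : Finset ι) (hA : A ⊆ J) (B : Finset ι) :
    B ⊆ A → ∑ j ∈ B, (h A - h (A.erase j)) ≤ h B - h ∅ := by
  induction B using Finset.induction_on with
  | empty => intro _; simp
  | insert b B hb ih =>
    intro hB
    have hbA : b ∈ A := hB (mem_insert_self _ _)
    have hBA : B ⊆ A := fun x hx => hB (mem_insert_of_mem hx)
    have ih' := ih hBA
    rw [Finset.sum_insert hb]
    have h1 := hsub (insert b B) (A.erase b) (hB.trans hA) ((erase_subset _ _).trans hA)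
    have e1 : insert b B ∪ A.erase b = A := by
      ext x
      by_cases hx : x = b
      · subst hx; simp [hbA]
      · simp only [mem_union, mem_insert, mem_erase, hx]
        have := @hBA x
        tauto
    have e2 : insert b B ∩ A.erase b = B := by
      ext x
      by_cases hx : x = b
      · subst hx; simp [hb]
      · simp only [mem_inter, mem_insert, mem_erase, hx]
        have := @hBA x
        tauto
    rw [e1, e2] at h1
    linarith

lemma local_search {ι : Type*} [DecidableEq ι] (J : Finset ι) (f : Finset ι → ℝ)
    (hf0 : f ∅ = 0)
    (hmono : ∀ S T : Finset ι, S ⊆ T → T ⊆ J → f S ≤ f T)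
    (hsub : ∀ S T : Finset ι, S ⊆ J → T ⊆ J → f (S ∪ T) + f (S ∩ T) ≤ f S + f T)
    (t : ℝ) (ht : 0 < t) (y : Finset ι → ℝ) (hy : ∀ C, 0 ≤ y C) (m : ℕ)
    (hm : (m : ℝ) ≤ ∑ C ∈ J.powerset with 3 * t ≤ f C, y C)
    (hj : ∀ j ∈ J, ∑ C ∈ J.powerset with (3 * t ≤ f C ∧ j ∈ C), y C ≤ 1)
    (hsmall : ∀ j ∈ J, f {j} < t) :
    ∃ A : Fin m → Finset ι, (∀ p, A p ⊆ J) ∧ (∀ p q, p ≠ q → Disjoint (A p) (A q)) ∧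
      ∀ p, t ≤ f (A p) := by
  classical
  set g : Finset ι → ℝ := fun S => min (f S) (2 * t) with hg
  have gmono : ∀ S T : Finset ι, S ⊆ T → T ⊆ J → g S ≤ g T := fun S T h1 h2 =>
    min_le_min_right _ (hmono S T h1 h2)
  have gsub : ∀ S T : Finset ι, S ⊆ J → T ⊆ J → g (S ∪ T) + g (S ∩ T) ≤ g S + g T := by
    intro S T hS hT
    have hU : S ∪ T ⊆ J := union_subset hS hT
    have a1 := gmono (S ∩ T) T inter_subset_right hT
    have a2 := gmono (S ∩ T) S inter_subset_left hS
    have a3 : g (S ∪ T) ≤ 2 * t := min_le_right _ _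
    have a4 : g (S ∪ T) ≤ f (S ∪ T) := min_le_left _ _
    have a5 : g (S ∩ T) ≤ f (S ∩ T) := min_le_left _ _
    have a6 := hsub S T hS hT
    rcases le_total (2 * t) (f S) with h | h
    · have : g S = 2 * t := min_eq_right h
      linarith
    · rcases le_total (2 * t) (f T) with h' | h'
      · have : g T = 2 * t := min_eq_right h'
        linarith
      · have b1 : g S = f S := min_eq_left h
        have b2 : g T = f T := min_eq_left h'
        linarith
  have g0 : g ∅ = 0 := by simp [hg, hf0, ht.le]
  let F : Finset (Fin m → Finset ι) :=
    (Fintype.piFinset (fun _ : Fin m => J.powerset)).filter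
      (fun A => ∀ p q, p ≠ q → Disjoint (A p) (A q))
  have memF : ∀ A, A ∈ F ↔ (∀ p, A p ⊆ J) ∧ (∀ p q, p ≠ q → Disjoint (A p) (A q)) := by
    intro A; simp [F, Fintype.mem_piFinset]
  have hF : F.Nonempty := ⟨fun _ => ∅, (memF _).2 ⟨by simp, by simp⟩⟩
  obtain ⟨A, hAF, hmax⟩ := F.exists_max_image (fun A => ∑ p, g (A p)) hF
  obtain ⟨hAJ, hAd⟩ := (memF A).1 hAF
  refine ⟨A, hAJ, hAd, ?_⟩
  by_contra! hcon
  obtain ⟨i, hi⟩ := hcon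
  -- local optimality
  have hopt : ∀ j ∈ J, f (insert j (A i)) - f (A i) ≤
      ∑ p ∈ univ.erase i, (g (A p) - g ((A p).erase j)) := by
    intro j hjJ
    have hins : insert j (A i) ⊆ J := insert_subset hjJ (hAJ i)
    let B : Fin m → Finset ι := fun p => if p = i then insert j (A i) else (A p).erase j
    have hB : B ∈ F := by
      refine (memF _).2 ⟨?_, ?_⟩
      · intro p
        by_cases hp : p = i
        · simp only [B, hp, if_true]; exact hins
        · simp only [B, hp, if_false]; exact (erase_subset _ _).trans (hAJ p)
      · intro p q hpq
        have hd := hAd p q hpq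
        rw [Finset.disjoint_left] at hd ⊢
        intro x
        by_cases hp : p = i <;> by_cases hq : q = i
        · exact absurd (hp.trans hq.symm) hpq
        · subst hp
          simp only [B, hq, if_true, if_false, mem_insert, mem_erase]
          have := @hd x; tauto
        · subst hq
          simp only [B, hp, if_true, if_false, mem_insert, mem_erase]
          have := @hd x; tauto
        · simp only [B, hp, hq, if_false, mem_erase]
          have := @hd x; tauto
    have h1 := hmax B hB
    rw [← Finset.add_sum_erase univ _ (mem_univ i),
      ← Finset.add_sum_erase univ (fun p => g (A p)) (mem_univ i)] at h1
    have e1 : ∑ p ∈ univ.erase i, g (B p) = ∑ p ∈ univ.erase i, g ((A p).erase j) := by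
      refine Finset.sum_congr rfl fun p hp => ?_
      simp only [B, (mem_erase.1 hp).1, if_false]
    have e2 : g (B i) = f (insert j (A i)) := by
      simp only [B, if_true]
      refine min_eq_left ?_
      have h2 := hsub (A i) {j} (hAJ i) (by simpa using hjJ)
      have h3 : A i ∪ {j} = insert j (A i) := by ext x; simp
      have h4 := hmono ∅ (A i ∩ {j}) (empty_subset _) (inter_subset_left.trans (hAJ i))
      have h5 := hsmall j hjJ
      rw [h3] at h2
      linarith
    have e3 : g (A i) = f (A i) := min_eq_left (by linarith)
    rw [Finset.sum_sub_distrib]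
    rw [e1, e2, e3] at h1
    linarith
  have hupper : ∑ j ∈ J, (f (insert j (A i)) - f (A i)) ≤ ((m : ℝ) - 1) * (2 * t) := by
    calc _ ≤ ∑ j ∈ J, ∑ p ∈ univ.erase i, (g (A p) - g ((A p).erase j)) :=
          Finset.sum_le_sum hopt
      _ = ∑ p ∈ univ.erase i, ∑ j ∈ J, (g (A p) - g ((A p).erase j)) := Finset.sum_comm
      _ ≤ ∑ p ∈ univ.erase i, 2 * t := by
          refine Finset.sum_le_sum fun p _ => ?_
          rw [← Finset.sum_subset (hAJ p)]
          · have := loss_aux J g gsub (A p) (hAJ p) (A p) subset_rfl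
            have h2 : g (A p) ≤ 2 * t := min_le_right _ _
            linarith
          · intro x _ hx
            rw [erase_eq_of_notMem hx, sub_self]
      _ = _ := by
          have hmpos : 1 ≤ m := Nat.one_le_iff_ne_zero.2 (by rintro rfl; exact i.elim0)
          rw [Finset.sum_const, card_erase_of_mem (mem_univ i)]
          simp [Nat.cast_sub hmpos]
  have hlower : (m : ℝ) * (2 * t) ≤ ∑ j ∈ J, (f (insert j (A i)) - f (A i)) := by
    calc (m : ℝ) * (2 * t) ≤ (∑ C ∈ J.powerset with 3 * t ≤ f C, y C) * (2 * t) := by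
          gcongr
      _ = ∑ C ∈ J.powerset with 3 * t ≤ f C, y C * (2 * t) := Finset.sum_mul _ _ _
      _ ≤ ∑ C ∈ J.powerset with 3 * t ≤ f C, y C * ∑ j ∈ J,
            (if j ∈ C then (f (insert j (A i)) - f (A i)) else 0) := by
          refine Finset.sum_le_sum fun C hC => ?_
          obtain ⟨hCJ, hCf⟩ := mem_filter.1 hC
          rw [mem_powerset] at hCJ
          refine mul_le_mul_of_nonneg_left ?_ (hy C)
          rw [← Finset.sum_filter, filter_mem_eq_inter, inter_eq_right.2 hCJ]
          have h1 := gain_aux J f hsub hmono (A i) (hAJ i) C hCJ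
          have h2 := hmono C (A i ∪ C) subset_union_right (union_subset (hAJ i) hCJ)
          linarith
      _ = ∑ j ∈ J, (f (insert j (A i)) - f (A i)) *
            ∑ C ∈ J.powerset with (3 * t ≤ f C ∧ j ∈ C), y C := by
          simp_rw [Finset.mul_sum]
          rw [Finset.sum_comm]
          refine Finset.sum_congr rfl fun j _ => ?_
          rw [← Finset.filter_filter, Finset.sum_filter (fun C => j ∈ C)]
          refine Finset.sum_congr rfl fun C _ => ?_
          split_ifs <;> ring
      _ ≤ _ := by
          refine Finset.sum_le_sum fun j hjJ => ?_
          have h1 := hmono (A i) (insert j (A i)) (subset_insert _ _)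
            (insert_subset hjJ (hAJ i))
          exact mul_le_of_le_one_right (by linarith) (hj j hjJ)
  nlinarith

lemma rounding {ι : Type*} [DecidableEq ι] (f : Finset ι → ℝ)
    (hf0 : f ∅ = 0) (t : ℝ) (ht : 0 < t) (y : Finset ι → ℝ) (hy : ∀ C, 0 ≤ y C) (m : ℕ) :
    ∀ J : Finset ι,
    (∀ S T : Finset ι, S ⊆ T → T ⊆ J → f S ≤ f T) →
    (∀ S T : Finset ι, S ⊆ J → T ⊆ J → f (S ∪ T) + f (S ∩ T) ≤ f S + f T) →
    ((m : ℝ) ≤ ∑ C ∈ J.powerset with 3 * t ≤ f C, y C) →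
    (∀ j ∈ J, ∑ C ∈ J.powerset with (3 * t ≤ f C ∧ j ∈ C), y C ≤ 1) →
    ∃ A : Fin m → Finset ι, (∀ p, A p ⊆ J) ∧ (∀ p q, p ≠ q → Disjoint (A p) (A q)) ∧
      ∀ p, t ≤ f (A p) := by
  induction m with
  | zero => intro J _ _ _ _; exact ⟨fun _ => ∅, by simp, by simp, fun p => p.elim0⟩
  | succ m ih =>
    intro J hmono hsub hm hj
    by_cases hbig : ∃ j ∈ J, t ≤ f {j}
    · obtain ⟨j, hjJ, hjt⟩ := hbig
      have hE : J.erase j ⊆ J := erase_subset _ _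
      have hfil : (J.erase j).powerset.filter (fun C => 3 * t ≤ f C) =
          (J.powerset.filter (fun C => 3 * t ≤ f C)).filter (fun C => ¬ j ∈ C) := by
        ext C
        simp only [mem_filter, mem_powerset, subset_erase]
        tauto
      obtain ⟨A, hA1, hA2, hA3⟩ := ih (J.erase j)
        (fun S T h1 h2 => hmono S T h1 (h2.trans hE))
        (fun S T h1 h2 => hsub S T (h1.trans hE) (h2.trans hE))
        (by
          have h1 := Finset.sum_filter_add_sum_filter_not
            (J.powerset.filter (fun C => 3 * t ≤ f C)) (fun C => j ∈ C) y
          have h2 := hj j hjJ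
          rw [← Finset.filter_filter] at h2
          rw [hfil]
          push_cast at hm
          linarith)
        (by
          intro k hk
          refine le_trans ?_ (hj k (hE hk))
          refine Finset.sum_le_sum_of_subset_of_nonneg ?_ (fun C _ _ => hy C)
          exact filter_subset_filter _ (powerset_mono.2 hE))
      have hjA : ∀ p, j ∉ A p := fun p hp => by simpa using hA1 p hp
      refine ⟨Fin.cons {j} A, ?_, ?_, ?_⟩
      · intro p
        refine Fin.cases ?_ (fun p => ?_) p
        · simpa using hjJ
        · simpa using (hA1 p).trans hE
      · intro p q
        refine Fin.cases ?_ (fun p => ?_) p <;> refine Fin.cases ?_ (fun q => ?_) q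
        · simp
        · intro _; simpa using hjA q
        · intro _; simpa using hjA p
        · intro h; simpa using hA2 p q (fun e => h (by rw [e]))
      · intro p
        refine Fin.cases ?_ (fun p => ?_) p
        · simpa using hjt
        · simpa using hA3 p
    · push Not at hbig
      exact local_search J f hf0 hmono hsub t ht y hy (m + 1) hm hj hbig

/-- for identical monotone submodular valuations, the configuration LP is
infeasible at every threshold `T > 3·OPT`; i.e., its integrality gap is at most `3`. -/
theorem stmt14 {ι : Type*} [DecidableEq ι] (J : Finset ι) (f : Finset ι → ℝ)
    (hf0 : f ∅ = 0)
    (hmono : ∀ S T : Finset ι, S ⊆ T → T ⊆ J → f S ≤ f T)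
    (hsub : ∀ S T : Finset ι, S ⊆ J → T ⊆ J → f (S ∪ T) + f (S ∩ T) ≤ f S + f T)
    {m : ℕ} (hm : 1 ≤ m)
    (OPT : ℝ)
    (hOPT : IsGreatest {t : ℝ | ∃ A : Fin m → Finset ι, IsAllocation J A ∧
      IsLeast (Set.range fun p => f (A p)) t} OPT) :
    ∀ T : ℝ, 3 * OPT < T → ¬ ConfigLPFeasible f J m T := by
  classical
  rintro T hT ⟨x, hx0, hx1, hx2⟩
  obtain ⟨⟨A0, hA0, hleast⟩, hub⟩ := hOPT
  have hpos : 0 ≤ OPT := by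
    obtain ⟨p, hp⟩ := hleast.1
    have := hmono ∅ (A0 p) (empty_subset _) (hA0.1 p)
    simp only at hp
    linarith
  have h3 : 3 * (T / 3) = T := by ring
  obtain ⟨A, hA1, hA2, hA3⟩ := rounding f hf0 (T / 3) (by linarith) (fun C => ∑ p, x p C)
    (fun C => Finset.sum_nonneg fun p _ => hx0 p C) m J hmono hsub
    (by
      rw [h3, Finset.sum_comm]
      calc (m : ℝ) = ∑ p : Fin m, (1 : ℝ) := by simp
        _ ≤ _ := Finset.sum_le_sum fun p _ => by convert hx1 p)
    (by
      intro j hj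
      rw [h3, Finset.sum_comm]
      convert hx2 j hj)
  let z : Fin m := ⟨0, hm⟩
  let B : Fin m → Finset ι := fun p =>
    if p = z then J.filter (fun j => ∀ q, q ≠ z → j ∉ A q) else A p
  have hAB : ∀ p, A p ⊆ B p := by
    intro p
    by_cases hp : p = z
    · intro j hj
      simp only [B, hp, if_true, mem_filter]
      exact ⟨hA1 p hj, fun q hq hjq =>
        Finset.disjoint_left.1 (hA2 p q (fun e => hq (e ▸ hp))) hj hjq⟩
    · simp [B, hp]
  have hBJ : ∀ p, B p ⊆ J := by
    intro p
    by_cases hp : p = z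
    · simp only [B, hp, if_true]; exact filter_subset _ _
    · simp only [B, hp, if_false]; exact hA1 p
  have hB : IsAllocation J B := by
    refine ⟨hBJ, ?_, ?_⟩
    · intro p q hpq
      rw [Finset.disjoint_left]
      intro j
      by_cases hp : p = z <;> by_cases hq : q = z
      · exact absurd (hp.trans hq.symm) hpq
      · simp only [B, hp, hq, if_true, if_false, mem_filter]
        exact fun h => h.2 q hq
      · simp only [B, hp, hq, if_true, if_false, mem_filter]
        exact fun h h' => h'.2 p hp h
      · simp only [B, hp, hq, if_false]
        exact fun h => Finset.disjoint_left.1 (hA2 p q hpq) h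
    · intro j hj
      by_cases h : ∃ q, q ≠ z ∧ j ∈ A q
      · obtain ⟨q, _, hq⟩ := h
        exact ⟨q, hAB q hq⟩
      · push Not at h
        refine ⟨z, ?_⟩
        simp only [B, if_true, mem_filter]
        exact ⟨hj, h⟩
  have : Nonempty (Fin m) := ⟨z⟩
  obtain ⟨p0, hp0⟩ := Finite.exists_min (fun p => f (B p))
  have h1 : f (B p0) ≤ OPT :=
    hub ⟨B, hB, ⟨p0, rfl⟩, by rintro _ ⟨p, rfl⟩; exact hp0 p⟩
  have h2 := hmono (A p0) (B p0) (hAB p0) (hBJ p0)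
  have h4 := hA3 p0
  linarith
end

section
/- Let f be a monotone submodular valuation with f(∅) = 0 on a finite item set J, let m ≥ 1, let OPT be the maximum over partitions of J into m parts of the minimum part value, and suppose f({j}) ≤ OPT for every item j ∈ J. Then there exists y : J → ℝ_{≥0} with ∑_{j∈J} y_j ≤ m such that ∑_{j∈S} y_j > 1 for every S ⊆ J with f(S) > 3·OPT. -/
open Finset

lemma aux_up {ι : Type*} [DecidableEq ι] (J : Finset ι) (f : Finset ι → ℝ)
    (hmono : ∀ S T : Finset ι, S ⊆ T → T ⊆ J → f S ≤ f T)
    (hsub : ∀ S T : Finset ι, S ⊆ J → T ⊆ J → f (S ∪ T) + f (S ∩ T) ≤ f S + f T)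
    (A : Finset ι) (hA : A ⊆ J) (T : Finset ι) (hT : T ⊆ J) :
    f (A ∪ T) - f A ≤ ∑ j ∈ T, (f (insert j A) - f A) := by
  induction T using Finset.induction_on with
  | empty => simp
  | insert a T ha ih =>
    rw [Finset.sum_insert ha]
    have haJ : a ∈ J := hT (Finset.mem_insert_self _ _)
    have hTJ : T ⊆ J := fun x hx => hT (Finset.mem_insert_of_mem hx)
    have h1 := ih hTJ
    have hi : insert a A ⊆ J := Finset.insert_subset haJ hA
    have hu : A ∪ T ⊆ J := Finset.union_subset hA hTJ
    have h2 := hsub (insert a A) (A ∪ T) hi hu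
    have e : insert a A ∪ (A ∪ T) = A ∪ insert a T := by grind
    have h3 := hmono A (insert a A ∩ (A ∪ T)) (by grind) (by grind)
    rw [e] at h2
    linarith

lemma aux_down {ι : Type*} [DecidableEq ι] (J : Finset ι) (f : Finset ι → ℝ)
    (hmono : ∀ S T : Finset ι, S ⊆ T → T ⊆ J → f S ≤ f T)
    (hsub : ∀ S T : Finset ι, S ⊆ J → T ⊆ J → f (S ∪ T) + f (S ∩ T) ≤ f S + f T)
    (A : Finset ι) (hA : A ⊆ J) (T : Finset ι) :
    ∑ j ∈ T, (f A - f (A.erase j)) ≤ f A - f (A \ T) := by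
  induction T using Finset.induction_on with
  | empty => simp
  | insert a T ha ih =>
    rw [Finset.sum_insert ha]
    have h2 := hsub (A.erase a) (A \ T) (by grind) (by grind)
    have e : A.erase a ∩ (A \ T) = A \ insert a T := by grind
    have e2 : A.erase a ∪ (A \ T) = A := by grind
    rw [e, e2] at h2
    linarith

/-- if every single item has value at most `OPT`, then there is a nonnegative
`y` with total mass at most `m` such that every set `S ⊆ J` with `f(S) > 3·OPT` is hit with
total `y`-weight strictly more than `1`. -/
theorem stmt15 {ι : Type*} [DecidableEq ι] (J : Finset ι) (f : Finset ι → ℝ)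
    (hf0 : f ∅ = 0)
    (hmono : ∀ S T : Finset ι, S ⊆ T → T ⊆ J → f S ≤ f T)
    (hsub : ∀ S T : Finset ι, S ⊆ J → T ⊆ J → f (S ∪ T) + f (S ∩ T) ≤ f S + f T)
    {m : ℕ} (hm : 1 ≤ m)
    (OPT : ℝ)
    (hOPT : IsGreatest {t : ℝ | ∃ A : Fin m → Finset ι, IsAllocation J A ∧
      IsLeast (Set.range fun p => f (A p)) t} OPT)
    (hsmall : ∀ j ∈ J, f {j} ≤ OPT) :
    ∃ y : ι → ℝ, (∀ j, 0 ≤ y j) ∧ ∑ j ∈ J, y j ≤ (m : ℝ) ∧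
      ∀ S ⊆ J, 3 * OPT < f S → 1 < ∑ j ∈ S, y j := by
  obtain ⟨⟨B, hB, ⟨⟨q, hq⟩, -⟩⟩, hub⟩ := hOPT
  have hnn : ∀ S ⊆ J, 0 ≤ f S := fun S hS => hf0 ▸ hmono ∅ S (by simp) hS
  have h0 : 0 ≤ OPT := by
    rw [← hq]; exact hnn _ (hB.1 q)
  rcases h0.eq_or_lt with h0 | hpos
  · refine ⟨fun _ => 0, by simp, by simp, fun S hS h => ?_⟩
    exfalso
    have h1 := aux_up J f hmono hsub ∅ (by simp) S hS
    have h2 : ∑ j ∈ S, (f (insert j ∅) - f ∅) ≤ 0 := by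
      apply Finset.sum_nonpos
      intro j hj
      have := hsmall j (hS hj)
      simp only [insert_empty_eq, hf0]
      linarith
    simp only [Finset.empty_union, hf0] at h1 h2
    linarith
  -- truncated valuation
  obtain ⟨g, hg⟩ : ∃ g : Finset ι → ℝ, ∀ S, g S = min (f S) (2 * OPT) := ⟨_, fun _ => rfl⟩
  have gmono : ∀ S T : Finset ι, S ⊆ T → T ⊆ J → g S ≤ g T := by
    intro S T h1 h2
    rw [hg, hg]
    exact min_le_min_right _ (hmono S T h1 h2)
  have gsub : ∀ S T : Finset ι, S ⊆ J → T ⊆ J → g (S ∪ T) + g (S ∩ T) ≤ g S + g T := by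
    intro S T hS hT
    have h1 := hsub S T hS hT
    have h2 := hmono (S ∩ T) S Finset.inter_subset_left hS
    have h3 := hmono (S ∩ T) T Finset.inter_subset_right hT
    have h4 := hmono S (S ∪ T) Finset.subset_union_left (Finset.union_subset hS hT)
    have h5 := hmono T (S ∪ T) Finset.subset_union_right (Finset.union_subset hS hT)
    simp only [hg, min_def]
    split_ifs <;> linarith
  have hfin : {A : Fin m → Finset ι | IsAllocation J A}.Finite := by
    apply (Set.Finite.pi (fun _ : Fin m => J.powerset.finite_toSet)).subset
    intro A hA
    simp only [Set.mem_pi, Finset.mem_coe, Finset.mem_powerset]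
    intro p _
    exact hA.1 p
  obtain ⟨A, hA, hmax⟩ := Set.exists_max_image _ (fun A : Fin m → Finset ι => ∑ p, g (A p)) hfin ⟨B, hB⟩
  have hA : IsAllocation J A := hA
  haveI : Nonempty (Fin m) := ⟨q⟩
  obtain ⟨i, hi⟩ := Finite.exists_min (fun p => f (A p))
  have hAi : f (A i) ≤ OPT := hub ⟨A, hA, ⟨i, rfl⟩, by rintro _ ⟨p, rfl⟩; exact hi p⟩
  have hle : ∀ j ∈ J, f (insert j (A i)) ≤ 2 * OPT := by
    intro j hj
    have h1 := hsub {j} (A i) (by simpa using hj) (hA.1 i)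
    have h2 := hnn ({j} ∩ A i) (by have := hA.1 i; grind)
    have h3 := hsmall j hj
    rw [← Finset.insert_eq] at h1
    linarith
  have hopt : ∀ j ∈ J \ A i, f (insert j (A i)) - f (A i) ≤
      ∑ p ∈ univ.erase i, (g (A p) - g ((A p).erase j)) := by
    intro j hj
    obtain ⟨hjJ, hjA⟩ := Finset.mem_sdiff.1 hj
    have hA' : IsAllocation J (fun p => if p = i then insert j (A i) else (A p).erase j) := by
      obtain ⟨ha, hb, hc⟩ := hA
      refine ⟨?_, ?_, ?_⟩
      · intro p
        have := ha p
        have := ha i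
        dsimp only
        split_ifs <;> grind
      · intro p r hpr
        have h1 := hb p r hpr
        have h2 := hb i r
        have h3 := hb p i
        rw [Finset.disjoint_left] at *
        dsimp only
        intro x
        split_ifs <;> grind [Finset.disjoint_left]
      · intro x hx
        by_cases hxj : x = j
        · exact ⟨i, by simp [hxj]⟩
        · obtain ⟨p, hp⟩ := hc x hx
          refine ⟨p, ?_⟩
          dsimp only
          split_ifs <;> grind
    have h := hmax _ hA'
    rw [← Finset.add_sum_erase _ _ (Finset.mem_univ i),
      ← Finset.add_sum_erase _ (fun p => g (A p)) (Finset.mem_univ i)] at h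
    rw [Finset.sum_congr rfl (g := fun p => g ((A p).erase j))
      (fun p hp => by rw [if_neg (Finset.ne_of_mem_erase hp)])] at h
    rw [if_pos rfl, hg (insert j (A i)), hg (A i), min_eq_left (hle j hjJ),
      min_eq_left (by linarith)] at h
    rw [Finset.sum_sub_distrib]
    linarith
  have hmarg : ∀ j ∈ J, 0 ≤ f (insert j (A i)) - f (A i) := fun j hj =>
    sub_nonneg.2 (hmono _ _ (Finset.subset_insert _ _) (Finset.insert_subset hj (hA.1 i)))
  have hz : ∀ j ∈ A i, f (insert j (A i)) - f (A i) = 0 := fun j hj => by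
    rw [Finset.insert_eq_of_mem hj, sub_self]
  have hsum : ∑ j ∈ J, (f (insert j (A i)) - f (A i)) ≤ m * (2 * OPT) := by
    rw [← Finset.sum_sdiff (hA.1 i), Finset.sum_eq_zero (s := A i) hz, add_zero]
    refine (Finset.sum_le_sum hopt).trans ?_
    rw [Finset.sum_comm]
    have h1 : ∀ p ∈ univ.erase i,
        ∑ j ∈ J \ A i, (g (A p) - g ((A p).erase j)) ≤ 2 * OPT := by
      intro p _
      have h := aux_down J g gmono gsub (A p) (hA.1 p) (J \ A i)
      have h2 : g (A p) ≤ 2 * OPT := by rw [hg]; exact min_le_right _ _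
      have h3 : 0 ≤ g (A p \ (J \ A i)) := by
        rw [hg]
        exact le_min (hnn _ (Finset.sdiff_subset.trans (hA.1 p))) (by linarith)
      linarith
    refine (Finset.sum_le_sum h1).trans ?_
    rw [Finset.sum_const, nsmul_eq_mul]
    refine mul_le_mul_of_nonneg_right ?_ (by linarith)
    have := Finset.card_le_univ ((univ : Finset (Fin m)).erase i)
    rw [Fintype.card_fin] at this
    exact_mod_cast this
  refine ⟨fun j => if j ∈ J then (f (insert j (A i)) - f (A i)) / (2 * OPT) else 0, ?_, ?_, ?_⟩
  · intro j
    dsimp only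
    split_ifs with h
    · exact div_nonneg (hmarg j h) (by linarith)
    · exact le_rfl
  · rw [Finset.sum_congr rfl (fun j hj => if_pos hj), ← Finset.sum_div,
      div_le_iff₀ (by linarith)]
    exact hsum
  · intro S hS h
    rw [Finset.sum_congr rfl (fun j hj => if_pos (hS hj)), ← Finset.sum_div,
      lt_div_iff₀ (by linarith)]
    have h1 := aux_up J f hmono hsub (A i) (hA.1 i) S hS
    have h2 := hmono S (A i ∪ S) Finset.subset_union_right (Finset.union_subset (hA.1 i) hS)
    linarith
end

section
/- Let J = {j_1, j_2, j_3, k_1, k_2, k_3} be a set of 6 items and define f : 2^J → ℝ by: f(∅) = 0; f(S) = 2 if |S| = 1; for |S| = 2, f(S) = 4 if S ⊆ {j_1,j_2,j_3} or S ⊆ {k_1,k_2,k_3}, and f(S) = 3 otherwise; f(S) = 4 if |S| ≥ 3. Then f is monotone and submodular, the configuration LP at threshold T = 4 with m = 3 players is feasible, and every partition of J into 3 parts (A_1, A_2, A_3) satisfies min_p f(A_p) ≤ 3. Consequently, the integrality gap of the configuration LP with identical submodular valuations is at least 4/3, even with 6 items and 3 players. -/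
open Finset

/-- The valuation of Proposition 4 (lower bound on the integrality gap): items
`j_1,j_2,j_3 = 0,1,2` and `k_1,k_2,k_3 = 3,4,5`; `f(∅)=0`, singletons get value `2`, pairs
get `4` if both items are from the same group and `3` otherwise, and sets of size `≥ 3`
get value `4`. -/
noncomputable def f16 (S : Finset (Fin 6)) : ℝ :=
  if S.card = 0 then 0
  else if S.card = 1 then 2
  else if S.card = 2 then
    (if S ⊆ ({0, 1, 2} : Finset (Fin 6)) ∨ S ⊆ ({3, 4, 5} : Finset (Fin 6)) then 4 else 3)
  else 4

/-- The valuation in terms of the number of items from each group. -/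
def g16 (a b : ℕ) : ℕ :=
  if a + b = 0 then 0
  else if a + b = 1 then 2
  else if a + b = 2 then (if a = 0 ∨ b = 0 then 4 else 3)
  else 4

/-- First group. -/
def J16 : Finset (Fin 6) := {0, 1, 2}
/-- Second group. -/
def K16 : Finset (Fin 6) := {3, 4, 5}

lemma card16 (S : Finset (Fin 6)) : S.card = (S ∩ J16).card + (S ∩ K16).card := by
  revert S; decide

lemma subJ16 (S : Finset (Fin 6)) : S ⊆ ({0, 1, 2} : Finset (Fin 6)) ↔ (S ∩ K16).card = 0 := by
  revert S; decide

lemma subK16 (S : Finset (Fin 6)) : S ⊆ ({3, 4, 5} : Finset (Fin 6)) ↔ (S ∩ J16).card = 0 := by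
  revert S; decide

lemma f16_eq (S : Finset (Fin 6)) : f16 S = (g16 (S ∩ J16).card (S ∩ K16).card : ℕ) := by
  unfold f16 g16
  simp only [subJ16, subK16]
  rw [card16]
  split_ifs <;> first | omega | norm_num

lemma g16_mono (a b c d : ℕ) (h : a ≤ c) (h' : b ≤ d) (hc : c ≤ 3) (hd : d ≤ 3) :
    g16 a b ≤ g16 c d := by
  unfold g16
  split_ifs <;> omega

set_option synthInstance.maxHeartbeats 400000 in
set_option synthInstance.maxSize 5000 in
lemma g16_sub : ∀ a < 4, ∀ b < 4, ∀ c < 4, ∀ d < 4, ∀ u < 4, ∀ v < 4,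
    u ≤ a → u ≤ c → v ≤ b → v ≤ d →
    g16 (a + c - u) (b + d - v) + g16 u v ≤ g16 a b + g16 c d := by
  decide +kernel

lemma cardJ16 (S : Finset (Fin 6)) : (S ∩ J16).card ≤ 3 :=
  card_le_card (inter_subset_right (s₁ := S) (s₂ := J16))
lemma cardK16 (S : Finset (Fin 6)) : (S ∩ K16).card ≤ 3 :=
  card_le_card (inter_subset_right (s₁ := S) (s₂ := K16))

lemma card_union16 (S T X : Finset (Fin 6)) :
    ((S ∪ T) ∩ X).card = (S ∩ X).card + (T ∩ X).card - ((S ∩ T) ∩ X).card := by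
  have h := card_union_add_card_inter (S ∩ X) (T ∩ X)
  rw [← union_inter_distrib_right, ← inter_inter_distrib_right] at h
  omega

/-- The six pairs inside a group. -/
def P16 : Finset (Finset (Fin 6)) := {{0, 1}, {0, 2}, {1, 2}, {3, 4}, {3, 5}, {4, 5}}

lemma P16_val : ∀ C ∈ P16, 4 ≤ g16 (C ∩ J16).card (C ∩ K16).card := by decide

lemma P16_deg : ∀ j : Fin 6, (P16.filter (fun C => j ∈ C)).card = 2 := by decide

lemma lp16 : ConfigLPFeasible f16 Finset.univ 3 4 := by
  classical
  refine ⟨fun _ C => if C ∈ P16 then 1 / 6 else 0, ?_, ?_, ?_⟩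
  · intro p C
    positivity
  · intro p
    have hc : P16.card = 6 := by decide
    calc (1 : ℝ) = ∑ C ∈ P16, (if C ∈ P16 then 1 / 6 else 0) := by
          rw [Finset.sum_congr rfl (fun C hC => if_pos hC), Finset.sum_const, hc]; norm_num
      _ ≤ _ := by
          apply Finset.sum_le_sum_of_subset_of_nonneg
          · intro C hC
            simp only [mem_filter, powerset_univ, mem_univ, true_and]
            rw [f16_eq]
            exact_mod_cast P16_val C hC
          · intros; positivity
  · intro j _
    have h : ∀ p : Fin 3, ∑ C ∈ (univ : Finset (Fin 6)).powerset.filter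
        (fun C => 4 ≤ f16 C ∧ j ∈ C), (if C ∈ P16 then (1 / 6 : ℝ) else 0) ≤ 1 / 3 := by
      intro _
      rw [← Finset.sum_filter]
      calc _ ≤ ∑ C ∈ P16.filter (fun C => j ∈ C), (1 / 6 : ℝ) := by
            apply Finset.sum_le_sum_of_subset_of_nonneg
            · intro C hC
              simp only [mem_filter] at hC ⊢
              exact ⟨hC.2, hC.1.2.2⟩
            · intros; positivity
        _ = 1 / 3 := by
            rw [Finset.sum_const]
            have := P16_deg j
            simp only [nsmul_eq_mul]
            convert_to ((2 : ℕ) : ℝ) * (1 / 6) = 1 / 3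
            · rw [← this]
            · norm_num
    have h3 := Finset.sum_le_sum (s := (univ : Finset (Fin 3))) (fun p _ => h p)
    have h4 : ∑ _p : Fin 3, (1 / 3 : ℝ) = 1 := by norm_num
    rw [h4] at h3
    refine le_trans (le_of_eq ?_) h3
    congr!

lemma alloc_card16 (A : Fin 3 → Finset (Fin 6)) (h : IsAllocation Finset.univ A)
    (X : Finset (Fin 6)) :
    (A 0 ∩ X).card + (A 1 ∩ X).card + (A 2 ∩ X).card = X.card := by
  obtain ⟨-, hd, hc⟩ := h
  have h1 : (univ.biUnion (fun p => A p ∩ X)) = X := by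
    ext j
    simp only [mem_biUnion, mem_univ, true_and, mem_inter]
    exact ⟨fun ⟨_, h⟩ => h.2, fun hj => (hc j (mem_univ j)).imp fun p hp => ⟨hp, hj⟩⟩
  have h2 := Finset.card_biUnion (s := univ) (t := fun p => A p ∩ X)
    (fun p _ q _ hpq => (hd p q hpq).mono inter_subset_left inter_subset_left)
  rw [h1, Fin.sum_univ_three] at h2
  exact h2.symm

lemma g16_big (a b : ℕ) (h : 3 < g16 a b) : 2 ≤ a + b ∧ (a + b = 2 → a = 0 ∨ b = 0) := by
  unfold g16 at h
  split_ifs at h <;> omega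

/-- `f16` is monotone and submodular, the configuration LP at threshold `4`
with `3` players is feasible, yet every partition of the six items into `3` parts has some
part of value at most `3`. Hence the integrality gap of the configuration LP with identical
submodular valuations is at least `4/3`, even with `6` items and `3` players. -/
theorem stmt16 :
    (∀ S T : Finset (Fin 6), S ⊆ T → f16 S ≤ f16 T) ∧
    (∀ S T : Finset (Fin 6), f16 (S ∪ T) + f16 (S ∩ T) ≤ f16 S + f16 T) ∧
    ConfigLPFeasible f16 Finset.univ 3 4 ∧
    (∀ A : Fin 3 → Finset (Fin 6), IsAllocation Finset.univ A → ∃ p, f16 (A p) ≤ 3) := by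
  refine ⟨?_, ?_, lp16, ?_⟩
  · intro S T h
    rw [f16_eq, f16_eq]
    exact_mod_cast g16_mono _ _ _ _ (card_le_card (inter_subset_inter_right h))
      (card_le_card (inter_subset_inter_right h)) (cardJ16 T) (cardK16 T)
  · intro S T
    simp only [f16_eq]
    rw [card_union16, card_union16]
    exact_mod_cast g16_sub _ (Nat.lt_succ_of_le (cardJ16 S)) _ (Nat.lt_succ_of_le (cardK16 S))
      _ (Nat.lt_succ_of_le (cardJ16 T)) _ (Nat.lt_succ_of_le (cardK16 T))
      _ (Nat.lt_succ_of_le (cardJ16 (S ∩ T))) _ (Nat.lt_succ_of_le (cardK16 (S ∩ T)))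
      (card_le_card (inter_subset_inter_right inter_subset_left))
      (card_le_card (inter_subset_inter_right inter_subset_right))
      (card_le_card (inter_subset_inter_right inter_subset_left))
      (card_le_card (inter_subset_inter_right inter_subset_right))
  · intro A hA
    by_contra! hcon
    have hb : ∀ p, 3 < g16 (A p ∩ J16).card (A p ∩ K16).card := by
      intro p
      have := hcon p
      rw [f16_eq] at this
      exact_mod_cast this
    have h0 := g16_big _ _ (hb 0)
    have h1 := g16_big _ _ (hb 1)
    have h2 := g16_big _ _ (hb 2)
    have hJ := alloc_card16 A hA J16
    have hK := alloc_card16 A hA K16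
    have e1 : J16.card = 3 := rfl
    have e2 : K16.card = 3 := rfl
    omega
end

section
/- Let f be a monotone submodular valuation with f(∅) = 0 on a finite item set J, let M_1,…,M_k be matroids on ground set J, and let m ≥ 1 be the number of players. Let OPT be the maximum, over all families (A_1,…,A_m) of pairwise disjoint subsets of J such that each A_p is independent in every matroid M_i, of min_p f(A_p). Then for every threshold T > 5·OPT, the matroid-constrained configuration LP at threshold T is infeasible. (In particular, the integrality gap of the configuration LP with identical submodular valuations and any number of matroid constraints is at most 5.) -/
open Finset

/-- `Indep` is the family of independent sets of a matroid on ground set `J`: it is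
nonempty, all members are subsets of `J`, it is closed under taking subsets, and for every
`X ⊆ J` all inclusion-maximal members contained in `X` have the same cardinality. -/
def IsMatroidFamily {ι : Type*} (J : Finset ι) (Indep : Finset ι → Prop) : Prop :=
  (∃ S, Indep S) ∧
  (∀ S, Indep S → S ⊆ J) ∧
  (∀ S T : Finset ι, Indep T → S ⊆ T → Indep S) ∧
  (∀ X : Finset ι, X ⊆ J → ∀ S T : Finset ι,
    Indep S → S ⊆ X → (∀ S', Indep S' → S' ⊆ X → S ⊆ S' → S' = S) →
    Indep T → T ⊆ X → (∀ T', Indep T' → T' ⊆ X → T ⊆ T' → T' = T) →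
    S.card = T.card)

open scoped Classical in
/-- The matroid-constrained configuration LP at threshold `T` for `m` players with identical
valuation `f` on items `J` is feasible, where the configurations are the sets `S ⊆ J` that
are independent in every given matroid and satisfy `f(S) ≥ T`. -/
def MatroidConfigLPFeasible {ι : Type*} (f : Finset ι → ℝ) (J : Finset ι)
    {k : ℕ} (Indep : Fin k → Finset ι → Prop) (m : ℕ) (T : ℝ) : Prop :=
  ∃ x : Fin m → Finset ι → ℝ,
    (∀ p C, 0 ≤ x p C) ∧
    (∀ p : Fin m,
      1 ≤ ∑ C ∈ J.powerset.filter (fun C => (∀ i, Indep i C) ∧ T ≤ f C), x p C) ∧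
    (∀ j ∈ J, ∑ p : Fin m,
      ∑ C ∈ J.powerset.filter (fun C => (∀ i, Indep i C) ∧ T ≤ f C ∧ j ∈ C), x p C ≤ 1)

lemma aux_trunc {ι : Type*} [DecidableEq ι] (f : Finset ι → ℝ) (L : ℝ)
    (hmono : ∀ S T : Finset ι, S ⊆ T → f S ≤ f T)
    (hsub : ∀ S T : Finset ι, f (S ∪ T) + f (S ∩ T) ≤ f S + f T) (S T : Finset ι) :
    min (f (S ∪ T)) L + min (f (S ∩ T)) L ≤ min (f S) L + min (f T) L := by
  have h1 := hmono (S ∩ T) S inter_subset_left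
  have h2 := hmono (S ∩ T) T inter_subset_right
  have h3 := hsub S T
  rcases le_total L (f S) with h | h
  · rw [min_eq_right h]
    have := min_le_right (f (S ∪ T)) L
    have := min_le_min_right L h2
    linarith
  · rcases le_total L (f T) with h' | h'
    · rw [min_eq_right h']
      have := min_le_right (f (S ∪ T)) L
      have := min_le_min_right L h1
      linarith
    · rw [min_eq_left h, min_eq_left h']
      have := min_le_left (f (S ∪ T)) L
      have := min_le_left (f (S ∩ T)) L
      linarith

lemma aux_marg {ι : Type*} [DecidableEq ι] (g : Finset ι → ℝ) (hg0 : g ∅ = 0)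
    (hmono : ∀ S T : Finset ι, S ⊆ T → g S ≤ g T)
    (hsub : ∀ S T : Finset ι, g (S ∪ T) + g (S ∩ T) ≤ g S + g T) (A : Finset ι) :
    ∃ a : ι → ℝ, (∀ j, 0 ≤ a j) ∧ ∑ j ∈ A, a j = g A ∧
      ∀ D, g A - g (A \ D) ≤ ∑ j ∈ A, if j ∈ D then a j else 0 := by
  induction A using Finset.induction_on with
  | empty => exact ⟨fun _ => 0, by simp, by simp [hg0], by simp⟩
  | insert x A hx ih =>
    obtain ⟨a, ha, hs, hD⟩ := ih
    refine ⟨fun j => if j = x then g (insert x A) - g A else a j, ?_, ?_, ?_⟩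
    · intro j
      dsimp only
      split_ifs
      · linarith [hmono A (insert x A) (subset_insert _ _)]
      · exact ha j
    · rw [sum_insert hx]
      have : ∑ j ∈ A, (if j = x then g (insert x A) - g A else a j) = ∑ j ∈ A, a j :=
        sum_congr rfl fun j hj => by rw [if_neg]; rintro rfl; exact hx hj
      rw [this, hs]; simp
    · intro D
      rw [sum_insert hx]
      have : ∑ j ∈ A, (if j ∈ D then (if j = x then g (insert x A) - g A else a j) else 0)
          = ∑ j ∈ A, if j ∈ D then a j else 0 :=
        sum_congr rfl fun j hj => by
          rw [if_neg (c := j = x)]; rintro rfl; exact hx hj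
      rw [this]
      have h := hD D
      by_cases hxD : x ∈ D
      · have e : insert x A \ D = A \ D := insert_sdiff_of_mem _ hxD
        rw [e]; simp only [hxD, if_true]; linarith
      · have h2 := hsub (insert x A \ D) A
        have e1 : (insert x A \ D) ∪ A = insert x A := by
          ext y; simp only [mem_union, mem_sdiff, mem_insert]
          by_cases hy : y = x
          · subst hy; tauto
          · tauto
        have e2 : (insert x A \ D) ∩ A = A \ D := by
          ext y; simp only [mem_inter, mem_sdiff, mem_insert]; tauto
        rw [e1, e2] at h2
        simp only [hxD, if_false]; linarith

lemma aux_piece {ι : Type*} [DecidableEq ι] (f : Finset ι → ℝ) (hf0 : f ∅ = 0)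
    (hsub : ∀ S T : Finset ι, f (S ∪ T) + f (S ∩ T) ≤ f S + f T)
    (τ : ℝ) (hτ : 0 < τ) (C : Finset ι) :
    (∀ j ∈ C, f {j} < τ) → 2 * τ ≤ f C → ∃ D ⊆ C, 2 * τ ≤ f D ∧ f D < 3 * τ := by
  induction C using Finset.induction_on with
  | empty => intro _ h; rw [hf0] at h; linarith
  | insert x A hx ih =>
    intro hj hC
    by_cases h : 2 * τ ≤ f A
    · obtain ⟨D, hD, h1⟩ := ih (fun j hjA => hj j (mem_insert_of_mem hjA)) h
      exact ⟨D, hD.trans (subset_insert _ _), h1⟩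
    · refine ⟨_, Subset.refl _, hC, ?_⟩
      have h1 := hsub {x} A
      have e : ({x} : Finset ι) ∩ A = ∅ := by simp [hx]
      rw [e, hf0, ← insert_eq] at h1
      have := hj x (mem_insert_self _ _)
      push Not at h
      linarith

lemma aux_local {ι : Type*} [DecidableEq ι] (f : Finset ι → ℝ) (hf0 : f ∅ = 0)
    (hmono : ∀ S T : Finset ι, S ⊆ T → f S ≤ f T)
    (hsub : ∀ S T : Finset ι, f (S ∪ T) + f (S ∩ T) ≤ f S + f T)
    (Good : Finset ι → Prop) (hG0 : Good ∅) (hG : ∀ S T, S ⊆ T → Good T → Good S)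
    (τ : ℝ) (hτ : 0 < τ) (w : Finset ι → ℝ) (hw : ∀ C, 0 ≤ w C)
    (n : ℕ) (J : Finset ι) (K : Finset (Finset ι))
    (hK : ∀ C ∈ K, C ⊆ J ∧ Good C ∧ 5 * τ ≤ f C)
    (hn : (n : ℝ) ≤ ∑ C ∈ K, w C)
    (hcov : ∀ j ∈ J, ∑ C ∈ K, (if j ∈ C then w C else 0) ≤ 1)
    (hsmall : ∀ C ∈ K, ∀ j ∈ C, f {j} < τ) :
    ∃ A : Fin n → Finset ι, (∀ p, A p ⊆ J ∧ Good (A p) ∧ τ ≤ f (A p)) ∧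
      ∀ p q, p ≠ q → Disjoint (A p) (A q) := by
  classical
  set g : Finset ι → ℝ := fun S => min (f S) (2 * τ) with hg
  have hg0 : g ∅ = 0 := by simp only [hg, hf0]; exact min_eq_left (by linarith)
  have hgm : ∀ S T : Finset ι, S ⊆ T → g S ≤ g T := fun S T h =>
    min_le_min_right _ (hmono S T h)
  have hgs : ∀ S T : Finset ι, g (S ∪ T) + g (S ∩ T) ≤ g S + g T :=
    aux_trunc f (2 * τ) hmono hsub
  let F : Finset (Fin n → Finset ι) := (Fintype.piFinset fun _ => J.powerset).filter
    fun A => (∀ p, Good (A p)) ∧ ∀ p q, p ≠ q → Disjoint (A p) (A q)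
  have hF : F.Nonempty := ⟨fun _ => ∅, by simp [F, hG0]⟩
  obtain ⟨A, hA, hmax⟩ := exists_max_image F (fun A => ∑ p, g (A p)) hF
  simp only [F, mem_filter, Fintype.mem_piFinset, mem_powerset] at hA hmax
  obtain ⟨hAJ, hAG, hAd⟩ := hA
  by_cases hall : ∀ p, τ ≤ f (A p)
  · exact ⟨A, fun p => ⟨hAJ p, hAG p, hall p⟩, hAd⟩
  exfalso
  push Not at hall
  obtain ⟨q, hq⟩ := hall
  have hswap : ∀ D, D ⊆ J → Good D → 2 * τ ≤ f D →
      2 * τ - g (A q) ≤ ∑ p ∈ univ.erase q, (g (A p) - g (A p \ D)) := by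
    intro D hDJ hDG hDf
    have h := hmax (fun p => if p = q then D else A p \ D) ⟨?_, ?_, ?_⟩
    · rw [← add_sum_erase univ _ (mem_univ q), ← add_sum_erase univ _ (mem_univ q)] at h
      have e : ∑ p ∈ univ.erase q, g (if p = q then D else A p \ D)
          = ∑ p ∈ univ.erase q, g (A p \ D) :=
        sum_congr rfl fun p hp => by rw [if_neg (ne_of_mem_erase hp)]
      rw [e, if_pos rfl] at h
      have : g D = 2 * τ := min_eq_right hDf
      rw [sum_sub_distrib]
      linarith
    · intro p; split_ifs
      · exact hDJ
      · exact sdiff_subset.trans (hAJ p)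
    · intro p; split_ifs
      · exact hDG
      · exact hG _ _ sdiff_subset (hAG p)
    · intro p r hpr; split_ifs with h1 h2 h2
      · exact absurd (h1.trans h2.symm) hpr
      · exact disjoint_sdiff
      · exact disjoint_sdiff.symm
      · exact (hAd p r hpr).mono sdiff_subset sdiff_subset
  choose a ha hs hD using fun p => aux_marg g hg0 hgm hgs (A p)
  have hC : ∀ C ∈ K, 2 * (2 * τ - g (A q)) ≤
      ∑ p ∈ univ.erase q, ∑ j ∈ A p, if j ∈ C then a p j else 0 := by
    intro C hCK
    obtain ⟨hCJ, hCG, hCf⟩ := hK C hCK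
    obtain ⟨D, hDC, hD2, hD3⟩ := aux_piece f hf0 hsub τ hτ C (hsmall C hCK) (by linarith)
    have h1 := hswap D (hDC.trans hCJ) (hG _ _ hDC hCG) hD2
    have h2 := hswap (C \ D) (sdiff_subset.trans hCJ) (hG _ _ sdiff_subset hCG) (by
      have h := hsub D (C \ D)
      rw [union_sdiff_of_subset hDC, inter_sdiff_self, hf0] at h
      linarith)
    have h3 : ∑ p ∈ univ.erase q, (g (A p) - g (A p \ D)) +
        ∑ p ∈ univ.erase q, (g (A p) - g (A p \ (C \ D))) ≤
        ∑ p ∈ univ.erase q, ∑ j ∈ A p, if j ∈ C then a p j else 0 := by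
      rw [← sum_add_distrib]
      refine sum_le_sum fun p _ => ?_
      refine (add_le_add (hD p D) (hD p (C \ D))).trans ?_
      rw [← sum_add_distrib]
      refine sum_le_sum fun j _ => ?_
      by_cases hjD : j ∈ D
      · simp [hjD, hDC hjD]
      · by_cases hjC : j ∈ C <;> simp [hjD, hjC]
    linarith
  have hgq : g (A q) < τ := lt_of_le_of_lt (min_le_left _ _) hq
  have hL : (n : ℝ) * (2 * (2 * τ - g (A q))) ≤ ∑ C ∈ K, w C * (2 * (2 * τ - g (A q))) := by
    rw [← sum_mul]
    exact mul_le_mul_of_nonneg_right hn (by linarith)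
  have hR : ∑ C ∈ K, w C * (2 * (2 * τ - g (A q))) ≤ ∑ p ∈ univ.erase q, g (A p) := by
    calc _ ≤ ∑ C ∈ K, w C * ∑ p ∈ univ.erase q, ∑ j ∈ A p, (if j ∈ C then a p j else 0) :=
          sum_le_sum fun C h => mul_le_mul_of_nonneg_left (hC C h) (hw C)
      _ = ∑ p ∈ univ.erase q, ∑ j ∈ A p, a p j * ∑ C ∈ K, (if j ∈ C then w C else 0) := by
          simp_rw [mul_sum]
          rw [sum_comm]
          refine sum_congr rfl fun p _ => ?_
          rw [sum_comm]
          refine sum_congr rfl fun j _ => sum_congr rfl fun C _ => ?_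
          split_ifs <;> ring
      _ ≤ ∑ p ∈ univ.erase q, ∑ j ∈ A p, a p j :=
          sum_le_sum fun p _ => sum_le_sum fun j hj =>
            mul_le_of_le_one_right (ha p j) (hcov j (hAJ p hj))
      _ = _ := sum_congr rfl fun p _ => hs p
  have hR2 : ∑ p ∈ univ.erase q, g (A p) ≤ n * (2 * τ) := by
    calc _ ≤ ∑ p ∈ univ.erase q, (2 * τ) := sum_le_sum fun p _ => min_le_right _ _
      _ ≤ ∑ p : Fin n, (2 * τ) :=
        sum_le_sum_of_subset_of_nonneg (erase_subset _ _) fun _ _ _ => by linarith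
      _ = _ := by simp
  have hn0 : (0 : ℝ) < n := by exact_mod_cast q.pos
  nlinarith

lemma aux_core {ι : Type*} [DecidableEq ι] (f : Finset ι → ℝ) (hf0 : f ∅ = 0)
    (hmono : ∀ S T : Finset ι, S ⊆ T → f S ≤ f T)
    (hsub : ∀ S T : Finset ι, f (S ∪ T) + f (S ∩ T) ≤ f S + f T)
    (Good : Finset ι → Prop) (hG0 : Good ∅) (hG : ∀ S T, S ⊆ T → Good T → Good S)
    (τ : ℝ) (hτ : 0 < τ) (w : Finset ι → ℝ) (hw : ∀ C, 0 ≤ w C)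
    (n : ℕ) : ∀ (J : Finset ι) (K : Finset (Finset ι))
    (_ : ∀ C ∈ K, C ⊆ J ∧ Good C ∧ 5 * τ ≤ f C)
    (_ : (n : ℝ) ≤ ∑ C ∈ K, w C)
    (_ : ∀ j ∈ J, ∑ C ∈ K, (if j ∈ C then w C else 0) ≤ 1),
    ∃ A : Fin n → Finset ι, (∀ p, A p ⊆ J ∧ Good (A p) ∧ τ ≤ f (A p)) ∧
      ∀ p q, p ≠ q → Disjoint (A p) (A q) := by
  induction n with
  | zero => intro J K _ _ _; exact ⟨fun _ => ∅, fun p => p.elim0, fun p => p.elim0⟩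
  | succ n ih =>
    intro J K hK hn hcov
    by_cases hsmall : ∀ C ∈ K, ∀ j ∈ C, f {j} < τ
    · exact aux_local f hf0 hmono hsub Good hG0 hG τ hτ w hw (n + 1) J K hK hn hcov hsmall
    push Not at hsmall
    obtain ⟨C, hC, j, hjC, hj⟩ := hsmall
    have hjJ : j ∈ J := (hK C hC).1 hjC
    obtain ⟨A, hA, hd⟩ := ih (J.erase j) (K.filter fun C => j ∉ C) (by
        intro C hC
        rw [mem_filter] at hC
        obtain ⟨h1, h2⟩ := hK C hC.1
        exact ⟨subset_erase.2 ⟨h1, hC.2⟩, h2⟩) (by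
        have h1 := hcov j hjJ
        rw [← sum_filter] at h1
        have h2 := sum_filter_add_sum_filter_not K (fun C => j ∈ C) w
        push_cast at hn
        linarith) (by
        intro i hi
        refine le_trans ?_ (hcov i (mem_of_mem_erase hi))
        refine sum_le_sum_of_subset_of_nonneg (filter_subset _ _) fun C _ _ => ?_
        split_ifs
        · exact hw C
        · exact le_rfl)
    have hdj : ∀ p, Disjoint ({j} : Finset ι) (A p) := fun p =>
      disjoint_singleton_left.2 fun h => notMem_erase j J ((hA p).1 h)
    refine ⟨Fin.cons {j} A, ?_, ?_⟩
    · intro p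
      refine Fin.cases ?_ (fun p => ?_) p
      · exact ⟨singleton_subset_iff.2 hjJ,
          hG _ _ (singleton_subset_iff.2 hjC) (hK C hC).2.1, hj⟩
      · exact ⟨(hA p).1.trans (erase_subset _ _), (hA p).2⟩
    · intro p q
      refine Fin.cases ?_ (fun p => ?_) p
      · refine Fin.cases ?_ (fun q => ?_) q
        · intro h; exact absurd rfl h
        · intro _; exact hdj q
      · refine Fin.cases ?_ (fun q => ?_) q
        · intro _; exact (hdj p).symm
        · intro h; exact hd p q fun e => h (by rw [e])

/-- with identical monotone submodular valuations and any number `k` of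
matroid constraints, the matroid-constrained configuration LP is infeasible at every
threshold `T > 5·OPT`; i.e., its integrality gap is at most `5`. -/
theorem stmt17 {ι : Type*} [DecidableEq ι] (J : Finset ι) (f : Finset ι → ℝ)
    (hf0 : f ∅ = 0)
    (hmono : ∀ S T : Finset ι, S ⊆ T → T ⊆ J → f S ≤ f T)
    (hsub : ∀ S T : Finset ι, S ⊆ J → T ⊆ J → f (S ∪ T) + f (S ∩ T) ≤ f S + f T)
    {k : ℕ} (Indep : Fin k → Finset ι → Prop)
    (hmatroid : ∀ i, IsMatroidFamily J (Indep i))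
    {m : ℕ} (hm : 1 ≤ m)
    (OPT : ℝ)
    (hOPT : IsGreatest {t : ℝ | ∃ A : Fin m → Finset ι,
      (∀ p, A p ⊆ J) ∧ (∀ p q : Fin m, p ≠ q → Disjoint (A p) (A q)) ∧
      (∀ p i, Indep i (A p)) ∧ IsLeast (Set.range fun p => f (A p)) t} OPT) :
    ∀ T : ℝ, 5 * OPT < T → ¬ MatroidConfigLPFeasible f J Indep m T := by
  classical
  intro T hT ⟨x, hx0, hx1, hx2⟩
  obtain ⟨⟨A₀, hA₀J, -, hA₀I, hA₀⟩, hub⟩ := hOPT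
  have hOPT0 : 0 ≤ OPT := by
    obtain ⟨p, hp⟩ := hA₀.1
    rw [← hp, ← hf0]
    exact hmono _ _ (empty_subset _) (hA₀J p)
  obtain ⟨A, hA, hd⟩ := aux_core (fun S => f (S ∩ J)) (by simp [hf0])
    (fun S T h => hmono _ _ (inter_subset_inter_right h) inter_subset_right)
    (fun S T => by
      have h := hsub (S ∩ J) (T ∩ J) inter_subset_right inter_subset_right
      have e1 : S ∩ J ∪ T ∩ J = (S ∪ T) ∩ J := (union_inter_distrib_right _ _ _).symm
      have e2 : (S ∩ J) ∩ (T ∩ J) = (S ∩ T) ∩ J := (inter_inter_distrib_right _ _ _).symm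
      rw [e1, e2] at h
      exact h)
    (fun S => ∀ i, Indep i S)
    (fun i => (hmatroid i).2.2.1 _ _ (hA₀I ⟨0, hm⟩ i) (empty_subset _))
    (fun S T h hT i => (hmatroid i).2.2.1 _ _ (hT i) h)
    (T / 5) (by linarith) (fun C => ∑ p, x p C) (fun C => sum_nonneg fun p _ => hx0 p C)
    m J (J.powerset.filter (fun C => (∀ i, Indep i C) ∧ T ≤ f C))
    (by
      intro C hC
      rw [mem_filter, mem_powerset] at hC
      refine ⟨hC.1, hC.2.1, ?_⟩
      rw [inter_eq_left.2 hC.1]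
      linarith [hC.2.2])
    (by
      rw [sum_comm]
      calc (m : ℝ) = ∑ p : Fin m, (1 : ℝ) := by simp
        _ ≤ _ := sum_le_sum fun p _ => by convert hx1 p)
    (by
      intro j hj
      refine le_trans (le_of_eq ?_) (hx2 j hj)
      rw [← sum_filter, sum_comm, filter_filter]
      refine sum_congr rfl fun p _ => sum_congr ?_ fun _ _ => rfl
      ext C
      simp only [mem_filter, and_assoc])
  have : Nonempty (Fin m) := ⟨⟨0, hm⟩⟩
  obtain ⟨p, hp⟩ := Finite.exists_min fun p => f (A p)
  have h1 : f (A p) ≤ OPT := hub ⟨A, fun p => (hA p).1, hd, fun p => (hA p).2.1,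
    ⟨p, rfl⟩, by rintro _ ⟨r, rfl⟩; exact hp r⟩
  have h2 := (hA p).2.2
  rw [inter_eq_left.2 (hA p).1] at h2
  linarith
end

section
/- Let f be a monotone submodular valuation with f(∅) = 0 on a finite item set, and let D be a finite set of items such that f({j}) ≤ 1 for every j ∈ D and f(D) > 5. Then there exists a partition D = D_1 ⊎ D_2 into two disjoint parts with f(D_1) ≥ 2 and f(D_2) ≥ 2. -/
open Finset

/-- if `f` is monotone submodular with `f(∅) = 0`, and `D` is a finite set of
items with `f({j}) ≤ 1` for every `j ∈ D` and `f(D) > 5`, then `D` can be partitioned into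
two disjoint parts, each of value at least `2`. -/
theorem stmt18 {ι : Type*} [DecidableEq ι] [Fintype ι]
    (f : Finset ι → ℝ) (hf0 : f ∅ = 0)
    (hmono : ∀ S T : Finset ι, S ⊆ T → f S ≤ f T)
    (hsub : ∀ S T : Finset ι, f (S ∪ T) + f (S ∩ T) ≤ f S + f T)
    (D : Finset ι) (hsmall : ∀ j ∈ D, f {j} ≤ 1) (hD : 5 < f D) :
    ∃ D1 D2 : Finset ι, Disjoint D1 D2 ∧ D1 ∪ D2 = D ∧ 2 ≤ f D1 ∧ 2 ≤ f D2 := by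
  obtain ⟨S, hS, hmin⟩ := Finset.exists_min_image
    (D.powerset.filter (fun S => 2 ≤ f S)) Finset.card
    ⟨D, by simp; linarith⟩
  simp only [Finset.mem_filter, Finset.mem_powerset] at hS hmin
  obtain ⟨hSD, hS2⟩ := hS
  refine ⟨S, D \ S, Finset.disjoint_sdiff, Finset.union_sdiff_of_subset hSD, hS2, ?_⟩
  have hne : S.Nonempty := by
    rw [Finset.nonempty_iff_ne_empty]
    rintro rfl
    linarith
  obtain ⟨j, hj⟩ := hne
  have h1 : f (S.erase j) < 2 := by
    by_contra h
    have h3 := hmin (S.erase j) ⟨(Finset.erase_subset j S).trans hSD, not_lt.mp h⟩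
    have h4 := Finset.card_erase_lt_of_mem hj
    omega
  have h2 := hsub (S.erase j) {j}
  have e1 : S.erase j ∪ {j} = S := by
    ext x
    by_cases hx : x = j <;> simp [hx, hj]
  have e2 : S.erase j ∩ {j} = ∅ := by
    ext x
    by_cases hx : x = j <;> simp [hx]
  rw [e1, e2, hf0] at h2
  have h5 := hsmall j (hSD hj)
  have h6 := hsub S (D \ S)
  rw [Finset.union_sdiff_of_subset hSD, Finset.inter_sdiff_self, hf0] at h6
  linarith
end
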